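/- There is no asymptotically consistent discrimination procedure for the set of all B-processes: for every discrimination procedure D (family of measurable maps D_n : A^n × A^n → {0,1}) there exist binary-valued B-processes ρ_x, ρ_y, independently generating sequences X_1,X_2,… and Y_1,Y_2,…, for which the expected output E D_n((X_1,…,X_n),(Y_1,…,Y_n)) fails to converge to 0 when ρ_x = ρ_y or fails to converge to 1 when ρ_x ≠ ρ_y. -/

import Mathlib

open MeasureTheory Filter Topology

namespace Paper

variable {A : Type*} [MeasurableSpace A]

/-- The left shift on one-sided infinite sequences. -/
def shift (x : ℕ → A) : ℕ → A := fun n => x (n + 1)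

/-- A process distribution is stationary if it is invariant under the left shift. -/
def Stationary (ρ : Measure (ℕ → A)) : Prop := Measure.map shift ρ = ρ

/-- A set of sequences depends only on the first `k` coordinates. -/
def DependsOn (B : Set (ℕ → A)) (k : ℕ) : Prop :=
  ∀ x y : ℕ → A, (∀ i < k, x i = y i) → (x ∈ B ↔ y ∈ B)

/-- Empirical frequency of the `k`-dimensional event `B` in the first `n` symbols of `x`. -/
noncomputable def freq (B : Set (ℕ → A)) (k n : ℕ) (x : ℕ → A) : ℝ :=
  if k ≤ n then
    (∑ i ∈ Finset.range (n - k + 1), Set.indicator B (fun _ => (1 : ℝ)) fun j => x (i + j)) /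
      ((n : ℝ) - k + 1)
  else 0

/-- Ergodicity: the empirical frequency of every finite-dimensional event converges
almost surely to a constant. -/
def ErgodicFreq (ρ : Measure (ℕ → A)) : Prop :=
  ∀ (k : ℕ) (B : Set (ℕ → A)), MeasurableSet B → DependsOn B k →
    ∃ c : ℝ, ∀ᵐ x ∂ρ, Tendsto (fun n => freq B k n x) atTop (𝓝 c)

/-- The cylinder set of sequences starting with the word `u`. -/
def listCyl (u : List A) : Set (ℕ → A) := {x | ∀ i : Fin u.length, x i = u.get i}

/-- `dbarLe ρx ρy ε` : there is a stationary coupling of `ρx` and `ρy` whose first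
coordinates disagree with probability at most `ε`; i.e., `d̄(ρx,ρy) ≤ ε` witnessed
by a coupling. -/
def dbarLe (ρx ρy : Measure (ℕ → A)) (ε : ℝ) : Prop :=
  ∃ ν : Measure (ℕ → A × A), IsProbabilityMeasure ν ∧ Stationary ν ∧
    ν.map (fun z => fun n => (z n).1) = ρx ∧
    ν.map (fun z => fun n => (z n).2) = ρy ∧
    ν {z | (z 0).1 ≠ (z 0).2} ≤ ENNReal.ofReal ε

/-- A (stationary) process is `k`-step Markov: the conditional probability of the next
symbol given the past depends only on the last `k` symbols, expressed via cylinder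
probabilities: `μ(w·a) μ(lastK) = μ(lastK·a) μ(w)` where `lastK` is the suffix of `w`
of length `k`. -/
def IsMarkovOfOrder (μ : Measure (ℕ → A)) (k : ℕ) : Prop :=
  ∀ (w : List A) (a : A), k ≤ w.length →
    μ (listCyl (w ++ [a])) * μ (listCyl (w.drop (w.length - k))) =
      μ (listCyl (w.drop (w.length - k) ++ [a])) * μ (listCyl w)

/-- Aperiodicity of a stationary `k`-step Markov process: for every word `u` of length `k`
of positive probability, the set of return times of `u` has greatest common divisor 1. -/
def AperiodicMarkov (μ : Measure (ℕ → A)) (k : ℕ) : Prop :=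
  ∀ u : List A, u.length = k → μ (listCyl u) ≠ 0 →
    ∀ d : ℕ,
      (∀ n : ℕ, 1 ≤ n →
        μ (listCyl u ∩ {x | ∀ i : Fin u.length, x (n + i) = u.get i}) ≠ 0 → d ∣ n) →
      d = 1

/-- A B-process: a stationary process in the `d̄`-closure of the set of all aperiodic
stationary ergodic `k`-step Markov processes, `k ∈ ℕ`. -/
def IsBProcess (ρ : Measure (ℕ → A)) : Prop :=
  IsProbabilityMeasure ρ ∧ Stationary ρ ∧
    ∀ ε : ℝ, 0 < ε →
      ∃ (μ : Measure (ℕ → A)) (k : ℕ),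
        IsProbabilityMeasure μ ∧ Stationary μ ∧ ErgodicFreq μ ∧
        IsMarkovOfOrder μ k ∧ AperiodicMarkov μ k ∧ dbarLe ρ μ ε

/-- The expected output `E D_n((X_1,…,X_n),(Y_1,…,Y_n))` of a discrimination procedure on
two independent samples generated by `ρx` and `ρy`. -/
noncomputable def expOut (D : (n : ℕ) → (Fin n → A) → (Fin n → A) → Bool)
    (ρx ρy : Measure (ℕ → A)) (n : ℕ) : ℝ :=
  ∫ z, (if D n (fun i => z.1 i) (fun i => z.2 i) then (1 : ℝ) else 0) ∂(ρx.prod ρy)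

open ProbabilityTheory

/-- Two-sided sequences of real innovations. -/
abbrev Path : Type := ℤ → ℝ

/-- The uniform distribution on `[0, 1)`. -/
noncomputable def unif : Measure ℝ := volume.restrict (Set.Ico 0 1)

instance : IsProbabilityMeasure unif := ⟨by simp [unif]⟩

/-- The law of i.i.d. uniform innovations. -/
noncomputable def iidLaw : Measure Path := Measure.infinitePi fun _ => unif

instance : IsProbabilityMeasure iidLaw := by unfold iidLaw; infer_instance

theorem unif_real_Iio {v : ℝ} (h0 : 0 ≤ v) (h1 : v ≤ 1) : unif.real (Set.Iio v) = v := by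
  have : Set.Iio v ∩ Set.Ico 0 1 = Set.Ico 0 v := by
    ext x; simp only [Set.mem_inter_iff, Set.mem_Iio, Set.mem_Ico]
    constructor
    · rintro ⟨a, b, c⟩; exact ⟨b, a⟩
    · rintro ⟨a, b⟩; exact ⟨b, a, b.trans_le h1⟩
  rw [measureReal_def, unif, Measure.restrict_apply measurableSet_Iio, this]
  simp [h0]

theorem unif_real_Ici {v : ℝ} (h0 : 0 ≤ v) (h1 : v ≤ 1) : unif.real (Set.Ici v) = 1 - v := by
  rw [← Set.compl_Iio, probReal_compl_eq_one_sub measurableSet_Iio, unif_real_Iio h0 h1]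

theorem unif_real_Icc_le {a b : ℝ} (h : a ≤ b) : unif.real (Set.Icc a b) ≤ b - a := by
  rw [measureReal_def, unif]
  refine ENNReal.toReal_le_of_le_ofReal (by linarith) ?_
  exact (Measure.restrict_apply_le _ _).trans (by simp)

theorem iidLaw_real_box (s : Finset ℤ) (t : ℤ → Set ℝ) (ht : ∀ i, MeasurableSet (t i)) :
    iidLaw.real {ω | ∀ i ∈ s, ω i ∈ t i} = ∏ i ∈ s, unif.real (t i) := by
  have : {ω : Path | ∀ i ∈ s, ω i ∈ t i} = Set.pi s t := by ext; simp [Set.mem_pi]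
  rw [measureReal_def, this, iidLaw, Measure.infinitePi_pi _ (fun i _ => ht i),
    ENNReal.toReal_prod]
  rfl

/-- Membership in `E` is determined by the coordinates in `S`. -/
def DeterminedBy (E : Set Path) (S : Set ℤ) : Prop :=
  ∀ ω ω' : Path, (∀ i ∈ S, ω i = ω' i) → (ω ∈ E ↔ ω' ∈ E)

theorem DeterminedBy.mono {E : Set Path} {S T : Set ℤ} (h : DeterminedBy E S) (hST : S ⊆ T) :
    DeterminedBy E T :=
  fun ω ω' hω => h ω ω' fun i hi => hω i (hST hi)

theorem DeterminedBy.inter {E F : Set Path} {S : Set ℤ} (hE : DeterminedBy E S)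
    (hF : DeterminedBy F S) : DeterminedBy (E ∩ F) S :=
  fun ω ω' hω => and_congr (hE ω ω' hω) (hF ω ω' hω)

theorem DeterminedBy.compl {E : Set Path} {S : Set ℤ} (hE : DeterminedBy E S) :
    DeterminedBy Eᶜ S :=
  fun ω ω' hω => not_congr (hE ω ω' hω)

theorem measurableSet_iSup_comap {E : Set Path} {S : Set ℤ} (hE : MeasurableSet E)
    (hS : DeterminedBy E S) :
    MeasurableSet[⨆ i ∈ S, MeasurableSpace.comap (fun ω : Path => ω i) inferInstance] E := by
  classical
  let π : Path → Path := fun ω i => if i ∈ S then ω i else 0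
  have hπ : π ⁻¹' E = E := by
    ext ω
    exact hS _ _ fun i hi => by simp [π, hi]
  rw [← hπ]
  refine (@measurable_pi_iff Path ℤ (fun _ => ℝ) (_) _ π).2 (fun i => ?_) hE
  by_cases hi : i ∈ S
  · simp only [π, hi, if_true]
    refine Measurable.mono (comap_measurable (fun ω : Path => ω i)) ?_ le_rfl
    exact le_iSup₂ (f := fun i (_ : i ∈ S) =>
      MeasurableSpace.comap (fun ω : Path => ω i) inferInstance) i hi
  · simp only [π, hi, if_false]
    exact @measurable_const _ _ _ (_) _

theorem iidLaw_inter {E F : Set Path} {S T : Set ℤ} (hST : Disjoint S T) (hE : MeasurableSet E)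
    (hF : MeasurableSet F) (hES : DeterminedBy E S) (hFT : DeterminedBy F T) :
    iidLaw (E ∩ F) = iidLaw E * iidLaw F := by
  have hind : iIndepFun (fun (i : ℤ) (ω : Path) => ω i) iidLaw := by
    rw [iIndepFun_iff_map_fun_eq_infinitePi_map (by fun_prop), Measure.map_id']
    unfold iidLaw
    congr
    funext i
    exact ((measurePreserving_eval_infinitePi (fun _ : ℤ => unif) i).map_eq).symm
  have := indep_iSup_of_disjoint (fun i => (measurable_pi_apply i).comap_le) hind hST
  exact (Indep_iff _ _ _).1 this E F (measurableSet_iSup_comap hE hES)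
    (measurableSet_iSup_comap hF hFT)

theorem iidLaw_real_inter {E F : Set Path} {S T : Set ℤ} (hST : Disjoint S T)
    (hE : MeasurableSet E) (hF : MeasurableSet F) (hES : DeterminedBy E S)
    (hFT : DeterminedBy F T) : iidLaw.real (E ∩ F) = iidLaw.real E * iidLaw.real F := by
  simp only [measureReal_def, iidLaw_inter hST hE hF hES hFT, ENNReal.toReal_mul]

/-- Translation of innovations. -/
def translate (n : ℤ) (ω : Path) : Path := fun i => ω (i + n)

theorem translate_translate (m n : ℤ) (ω : Path) :
    translate m (translate n ω) = translate (m + n) ω := by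
  funext i; simp [translate, add_assoc]

theorem translate_zero (ω : Path) : translate 0 ω = ω := by
  funext i; simp [translate]

theorem measurable_translate (n : ℤ) : Measurable (translate n) := by
  unfold translate; fun_prop

theorem measurePreserving_translate (n : ℤ) : MeasurePreserving (translate n) iidLaw iidLaw := by
  refine ⟨measurable_translate n, ?_⟩
  have := Measure.infinitePi_map_piCongrLeft (fun _ : ℤ => unif) (Equiv.addRight (-n))
  unfold iidLaw
  convert this using 2
  funext ω i
  have := Equiv.piCongrLeft_apply_apply (fun _ : ℤ => ℝ) (Equiv.addRight (-n)) ω (i + n)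
  simpa [translate, MeasurableEquiv.coe_piCongrLeft] using this.symm

/-- The one-sided stationary sequence read off by the symbol map `φ`. -/
def orbit {A : Type*} (φ : Path → A) (ω : Path) : ℕ → A := fun n => φ (translate n ω)

theorem measurable_orbit {A : Type*} [MeasurableSpace A] {φ : Path → A} (hφ : Measurable φ) :
    Measurable (orbit φ) :=
  measurable_pi_lambda _ fun n => hφ.comp (measurable_translate n)

/-- The law of the stationary sequence read off by `φ`. -/
noncomputable def factorLaw {A : Type*} [MeasurableSpace A] (φ : Path → A) : Measure (ℕ → A) :=
  iidLaw.map (orbit φ)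

theorem isProbabilityMeasure_factorLaw {A : Type*} [MeasurableSpace A] {φ : Path → A}
    (hφ : Measurable φ) : IsProbabilityMeasure (factorLaw φ) :=
  Measure.isProbabilityMeasure_map (measurable_orbit hφ).aemeasurable

theorem stationary_factorLaw {A : Type*} [MeasurableSpace A] {φ : Path → A}
    (hφ : Measurable φ) : Stationary (factorLaw φ) := by
  have hs : Measurable (shift : (ℕ → A) → ℕ → A) := by unfold shift; fun_prop
  unfold Stationary factorLaw
  rw [Measure.map_map hs (measurable_orbit hφ)]
  have : (shift ∘ orbit φ : Path → ℕ → A) = orbit φ ∘ translate 1 := by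
    funext ω n
    simp [shift, orbit, translate_translate]
  rw [this, ← Measure.map_map (measurable_orbit hφ) (measurable_translate 1),
    (measurePreserving_translate 1).map_eq]

theorem dbarLe_factorLaw {φ ψ : Path → Bool} (hφ : Measurable φ) (hψ : Measurable ψ) {ε : ℝ}
    (h : iidLaw.real {ω | φ ω ≠ ψ ω} ≤ ε) : dbarLe (factorLaw φ) (factorLaw ψ) ε := by
  have hm : Measurable fun ω => (φ ω, ψ ω) := hφ.prodMk hψ
  refine ⟨factorLaw fun ω => (φ ω, ψ ω), isProbabilityMeasure_factorLaw hm,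
    stationary_factorLaw hm, ?_, ?_, ?_⟩
  · rw [factorLaw, Measure.map_map (by fun_prop) (measurable_orbit hm)]
    rfl
  · rw [factorLaw, Measure.map_map (by fun_prop) (measurable_orbit hm)]
    rfl
  · have hS : MeasurableSet {z : ℕ → Bool × Bool | (z 0).1 ≠ (z 0).2} := by
      have : Measurable fun z : ℕ → Bool × Bool => z 0 := measurable_pi_apply 0
      exact this (Set.toFinite {p : Bool × Bool | p.1 ≠ p.2}).measurableSet
    rw [factorLaw, Measure.map_apply (measurable_orbit hm) hS]
    have : orbit (fun ω => (φ ω, ψ ω)) ⁻¹' {z | (z 0).1 ≠ (z 0).2} = {ω | φ ω ≠ ψ ω} := by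
      ext ω; simp [orbit, translate_zero]
    rw [this]
    exact (ENNReal.le_ofReal_iff_toReal_le (measure_ne_top _ _)
      (measureReal_nonneg.trans h)).2 h

theorem sum_range_mul_eq (x : ℕ → ℝ) (K n : ℕ) :
    ∑ i ∈ Finset.range (K * n), x i =
      ∑ r ∈ Finset.range K, ∑ j ∈ Finset.range n, x (K * j + r) := by
  induction n with
  | zero => simp
  | succ n ih =>
    rw [Nat.mul_succ, Finset.sum_range_add, ih, ← Finset.sum_add_distrib]
    exact Finset.sum_congr rfl fun r _ => (Finset.sum_range_succ _ _).symm

theorem tendsto_average_of_residues (x : ℕ → ℝ) (hx : ∀ i, 0 ≤ x i) (c : ℝ) (K : ℕ) (hK : 0 < K)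
    (h : ∀ r < K, Tendsto (fun n : ℕ => (∑ j ∈ Finset.range n, x (K * j + r)) / n) atTop (𝓝 c)) :
    Tendsto (fun n : ℕ => (∑ i ∈ Finset.range n, x i) / n) atTop (𝓝 c) := by
  have hK' : (0 : ℝ) < K := by exact_mod_cast hK
  refine tendsto_div_of_monotone_of_exists_subseq_tendsto_div
    (fun n => ∑ i ∈ Finset.range n, x i) c ?_ fun a ha => ⟨fun n => K * n, ?_, ?_, ?_⟩
  · exact monotone_nat_of_le_succ fun n => by
      rw [Finset.sum_range_succ]; linarith [hx n]
  · obtain ⟨n₀, hn₀⟩ := exists_nat_ge (1 / (a - 1))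
    filter_upwards [eventually_ge_atTop n₀] with n hn
    have h1 : (n₀ : ℝ) ≤ n := by exact_mod_cast hn
    have h2 : 1 ≤ n * (a - 1) := by
      rw [← div_le_iff₀ (by linarith)]; linarith
    push_cast
    nlinarith
  · exact tendsto_id.const_mul_atTop' hK
  · have := (tendsto_finsetSum (Finset.range K) fun r hr => h r (Finset.mem_range.1 hr)).div_const
      (K : ℝ)
    simp only [Finset.sum_const, Finset.card_range, nsmul_eq_mul] at this
    rw [mul_div_cancel_left₀ _ hK'.ne'] at this
    refine this.congr fun n => ?_
    rw [← Finset.sum_div, sum_range_mul_eq, div_div]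
    push_cast
    rw [mul_comm]

/-- The average number of visits to `E` along the first `N` translates. -/
noncomputable def average (E : Set Path) (ω : Path) (N : ℕ) : ℝ :=
  (∑ i ∈ Finset.range N, E.indicator (fun _ => (1 : ℝ)) (translate i ω)) / N

theorem DeterminedBy.translate {E : Set Path} {a b : ℤ} (h : DeterminedBy E (Set.Ico a b)) (n : ℤ) :
    DeterminedBy (translate n ⁻¹' E) (Set.Ico (a + n) (b + n)) := fun ω ω' hω =>
  h _ _ fun i hi => hω _ ⟨by linarith [hi.1], by linarith [hi.2]⟩

theorem tendsto_average_of_determinedBy {E : Set Path} (hE : MeasurableSet E) {a b : ℤ}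
    (h : DeterminedBy E (Set.Ico a b)) :
    ∀ᵐ ω ∂iidLaw, Tendsto (average E ω) atTop (𝓝 (iidLaw.real E)) := by
  set f : Path → ℝ := E.indicator fun _ => (1 : ℝ) with hf
  have hfm : Measurable f := measurable_const.indicator hE
  have hfE : ∀ s : Set ℝ, DeterminedBy (f ⁻¹' s) (Set.Ico a b) := fun s ω ω' hω => by
    have h1 := h ω ω' hω
    have : f ω = f ω' := by
      by_cases hω : ω ∈ E
      · simp [hf, hω, h1.1 hω]
      · simp [hf, hω, mt h1.2 hω]
    simp [Set.mem_preimage, this]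
  set K : ℕ := (b - a).toNat + 1 with hK
  have hlaw : ∀ r : ℕ, ∀ᵐ ω ∂iidLaw, Tendsto (fun n : ℕ => (∑ j ∈ Finset.range n,
      f (translate (K * j + r : ℕ) ω)) / n) atTop (𝓝 (iidLaw.real E)) := fun r => by
    have hmp : ∀ n : ℕ, MeasurePreserving (translate n) iidLaw iidLaw :=
      fun n => measurePreserving_translate n
    have hbd : Integrable f iidLaw := (integrable_const (1 : ℝ)).indicator hE
    have hint : ∀ n : ℕ, ∫ ω, f (translate n ω) ∂iidLaw = iidLaw.real E := fun n => by
      rw [← integral_map (measurable_translate n).aemeasurable hfm.aestronglyMeasurable,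
        (hmp n).map_eq, integral_indicator_const _ hE]
      simp
    rw [← hint (K * 0 + r)]
    refine strong_law_ae_real (fun (j : ℕ) ω => f (translate (K * j + r : ℕ) ω))
      ((hmp _).integrable_comp_of_integrable hbd) ?_ fun j => ⟨?_, ?_, ?_⟩
    · have key : ∀ i j : ℕ, i < j → IndepFun (fun ω => f (translate (K * i + r : ℕ) ω))
          (fun ω => f (translate (K * j + r : ℕ) ω)) iidLaw := fun i j hij => by
        rw [indepFun_iff_measure_inter_preimage_eq_mul]
        intro s t hs ht
        refine iidLaw_inter ?_ ((hfm.comp (measurable_translate _)) hs)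
          ((hfm.comp (measurable_translate _)) ht) ((hfE s).translate _) ((hfE t).translate _)
        rw [Set.disjoint_left]
        rintro x ⟨h1, h2⟩ ⟨h3, h4⟩
        have h5 : K * (i + 1) ≤ K * j := Nat.mul_le_mul_left _ hij
        have h6 : ((K * (i + 1) : ℕ) : ℤ) ≤ (K * j : ℕ) := by exact_mod_cast h5
        push_cast at h1 h2 h3 h4 h6
        have h7 : b - a ≤ K := by rw [hK]; push_cast; linarith [Int.self_le_toNat (b - a)]
        nlinarith
      intro i j hij
      rcases lt_or_gt_of_ne hij with h' | h'
      · exact key i j h'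
      · exact (key j i h').symm
    · exact (hfm.comp (measurable_translate _)).aemeasurable
    · exact (hfm.comp (measurable_translate _)).aemeasurable
    · have : ∀ n : ℕ, iidLaw.map (fun ω => f (translate n ω)) = iidLaw.map f := fun n => by
        rw [← (hmp n).map_eq, Measure.map_map hfm (measurable_translate n), (hmp n).map_eq]
        rfl
      rw [this, this]
  filter_upwards [ae_all_iff.2 hlaw] with ω hω
  exact tendsto_average_of_residues _ (fun i => Set.indicator_nonneg (fun _ _ => zero_le_one) _) _ K
    (Nat.succ_pos _) fun r _ => hω r

theorem abs_indicator_sub_le {E F B : Set Path} (h : ∀ ω ∉ B, ω ∈ F ↔ ω ∈ E) (ω : Path) :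
    |F.indicator (fun _ => (1 : ℝ)) ω - E.indicator (fun _ => (1 : ℝ)) ω| ≤
      B.indicator (fun _ => (1 : ℝ)) ω := by
  by_cases hB : ω ∈ B
  · by_cases h1 : ω ∈ F <;> by_cases h2 : ω ∈ E <;> simp [hB, h1, h2]
  · by_cases h1 : ω ∈ F
    · simp [hB, h1, (h ω hB).1 h1]
    · simp [hB, h1, mt (h ω hB).2 h1]

theorem abs_average_sub_le {E F B : Set Path} (h : ∀ ω ∉ B, ω ∈ F ↔ ω ∈ E) (ω : Path) (N : ℕ) :
    |average F ω N - average E ω N| ≤ average B ω N := by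
  unfold average
  rw [← sub_div, ← Finset.sum_sub_distrib, abs_div, Nat.abs_cast]
  gcongr
  exact (Finset.abs_sum_le_sum_abs _ _).trans
    (Finset.sum_le_sum fun i _ => abs_indicator_sub_le h _)

theorem abs_measureReal_sub_le {E F B : Set Path} (h : ∀ ω ∉ B, ω ∈ F ↔ ω ∈ E) :
    |iidLaw.real F - iidLaw.real E| ≤ iidLaw.real B := by
  have h1 : F ⊆ E ∪ B := fun ω hω => by
    by_cases hB : ω ∈ B
    · exact Or.inr hB
    · exact Or.inl ((h ω hB).1 hω)
  have h2 : E ⊆ F ∪ B := fun ω hω => by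
    by_cases hB : ω ∈ B
    · exact Or.inr hB
    · exact Or.inl ((h ω hB).2 hω)
  have h3 := (measureReal_mono (μ := iidLaw) h1).trans (measureReal_union_le _ _)
  have h4 := (measureReal_mono (μ := iidLaw) h2).trans (measureReal_union_le _ _)
  rw [abs_le]; constructor <;> linarith

theorem tendsto_average_of_approx {F : Set Path}
    (h : ∀ η > (0 : ℝ), ∃ (E B : Set Path) (a b : ℤ), MeasurableSet E ∧ MeasurableSet B ∧
      DeterminedBy E (Set.Ico a b) ∧ DeterminedBy B (Set.Ico a b) ∧ iidLaw.real B ≤ η ∧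
      ∀ ω ∉ B, ω ∈ F ↔ ω ∈ E) :
    ∀ᵐ ω ∂iidLaw, Tendsto (average F ω) atTop (𝓝 (iidLaw.real F)) := by
  choose E B a b hE hB hEd hBd hη hEB using fun m : ℕ =>
    h (1 / ((m : ℝ) + 1)) Nat.one_div_pos_of_nat
  filter_upwards [ae_all_iff.2 fun m => tendsto_average_of_determinedBy (hE m) (hEd m),
    ae_all_iff.2 fun m => tendsto_average_of_determinedBy (hB m) (hBd m)] with ω h1 h2
  rw [Metric.tendsto_atTop]
  intro ε hε
  obtain ⟨m, hm⟩ := exists_nat_one_div_lt (show 0 < ε / 4 by linarith)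
  obtain ⟨N₁, hN₁⟩ := Metric.tendsto_atTop.1 (h1 m) (ε / 4) (by linarith)
  obtain ⟨N₂, hN₂⟩ := Metric.tendsto_atTop.1 (h2 m) (ε / 4) (by linarith)
  refine ⟨max N₁ N₂, fun N hN => ?_⟩
  have e1 := hN₁ N (le_of_max_le_left hN)
  have e2 := hN₂ N (le_of_max_le_right hN)
  have e3 := abs_average_sub_le (hEB m) ω N
  have e4 := abs_measureReal_sub_le (hEB m)
  have e5 := hη m
  rw [Real.dist_eq] at *
  rw [abs_lt] at *
  rw [abs_le] at *
  constructor <;> linarith [e1.1, e1.2, e2.1, e2.2, e3.1, e3.2, e4.1, e4.2]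

theorem ergodicFreq_factorLaw {φ : Path → Bool} (hφ : Measurable φ)
    (h : ∀ η > (0 : ℝ), ∃ (φ' : Path → Bool) (N : Set Path) (a b : ℤ), Measurable φ' ∧
      MeasurableSet N ∧ (∀ ω ω', (∀ i ∈ Set.Ico a b, ω i = ω' i) → φ' ω = φ' ω') ∧
      DeterminedBy N (Set.Ico a b) ∧ iidLaw.real N ≤ η ∧ ∀ ω ∉ N, φ ω = φ' ω) :
    ErgodicFreq (factorLaw φ) := by
  intro k B hB hBk
  set F : Set Path := orbit φ ⁻¹' B with hF
  refine ⟨iidLaw.real F, ?_⟩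
  have hfreq : ∀ n, Measurable (freq B k n) := fun n => by
    unfold freq
    split_ifs
    · refine Measurable.div_const (Finset.measurable_sum _ fun i _ => ?_) _
      exact (measurable_const.indicator hB).comp (by fun_prop)
    · exact measurable_const
  rw [factorLaw, ae_map_iff (measurable_orbit hφ).aemeasurable
    (measurableSet_tendsto _ hfreq)]
  have key := tendsto_average_of_approx (F := F) fun η hη => by
    obtain ⟨φ', N, a, b, hφ', hN, hd, hNd, hNη, heq⟩ := h (η / (k + 1)) (by positivity)
    refine ⟨orbit φ' ⁻¹' B, ⋃ i ∈ Finset.range k, translate i ⁻¹' N, a, b + k,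
      measurable_orbit hφ' hB,
      Finset.measurableSet_biUnion _ fun i _ => measurable_translate i hN, ?_, ?_, ?_, ?_⟩
    · intro ω ω' hω
      refine hBk _ _ fun i hi => hd _ _ fun j hj => hω _ ⟨?_, ?_⟩
      · linarith [hj.1]
      · linarith [hj.2, show (i : ℤ) < k by exact_mod_cast hi]
    · intro ω ω' hω
      simp only [Set.mem_iUnion, Finset.mem_range, exists_prop]
      refine exists_congr fun i => and_congr_right fun hi => ?_
      refine hNd.translate i ω ω' fun j hj => hω _ ⟨?_, ?_⟩
      · linarith [hj.1]
      · linarith [hj.2, show (i : ℤ) < k by exact_mod_cast hi]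
    · calc iidLaw.real (⋃ i ∈ Finset.range k, translate i ⁻¹' N)
          ≤ ∑ i ∈ Finset.range k, iidLaw.real (translate i ⁻¹' N) :=
            measureReal_biUnion_finset_le _ _
        _ = k * iidLaw.real N := by
            simp [(measurePreserving_translate _).measureReal_preimage hN.nullMeasurableSet]
        _ ≤ k * (η / (k + 1)) := by gcongr
        _ ≤ η := by
            rw [mul_div_assoc', div_le_iff₀ (by positivity)]
            nlinarith
    · intro ω hω
      simp only [Set.mem_iUnion, Finset.mem_range, exists_prop, not_exists, not_and] at hω
      exact hBk _ _ fun i hi => heq _ (hω i hi)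
  filter_upwards [key] with ω hω
  rw [← tendsto_add_atTop_iff_nat k]
  refine ((tendsto_add_atTop_iff_nat 1).2 hω).congr fun n => ?_
  have h1 : (((n + k : ℕ) : ℝ) - k + 1) = ((n + 1 : ℕ) : ℝ) := by push_cast; ring
  rw [average, freq, if_pos (Nat.le_add_left k n), Nat.add_sub_cancel, h1]
  congr 1
  refine Finset.sum_congr rfl fun i _ => ?_
  have : orbit φ (translate i ω) = fun j => orbit φ ω (i + j) := by
    funext j
    simp [orbit, translate_translate, add_comm]
  simp only [Set.indicator]
  rw [← this]
  rfl

section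

/-- Transition rules: `g σ` is the probability of the symbol `true` after the past `σ`, listed with
the most recent symbol first. Only the last `L` symbols matter, and after the symbol `false`
the next symbol is a fair coin flip. -/
structure IsRule (g : (ℕ → Bool) → ℝ) (L : ℕ) (b : ℝ) : Prop where
  measurable : Measurable g
  lower : ∀ σ, 1 / 4 ≤ g σ
  upper : ∀ σ, g σ ≤ b
  bound_lt : b < 3 / 4
  fair : ∀ σ, σ 0 = false → g σ = 1 / 2
  pos : 0 < L
  finite_memory : ∀ σ τ, (∀ i < L, σ i = τ i) → g σ = g τ

/-- The past of `x` before time `n`, most recent symbol first. -/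
def recent (x : ℤ → Bool) (n : ℤ) : ℕ → Bool := fun i => x (n - 1 - i)

/-- At time `n` the sequence `x` is obtained from its past, the rule `g` and the innovation. -/
def Follows (g : (ℕ → Bool) → ℝ) (ω : Path) (x : ℤ → Bool) (n : ℤ) : Prop :=
  x n = decide (ω n < g (recent x n))

/-- The sequence driven by `g` and `ω` from time `a` on, started with a constant past. -/
noncomputable def sim (g : (ℕ → Bool) → ℝ) (ω : Path) (a : ℤ) (n : ℤ) : Bool :=
  if n < a then true else decide (ω n < g fun i => sim g ω a (n - 1 - i))
termination_by (n + 1 - a).toNat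
decreasing_by omega

/-- The two-sided stationary sequence driven by `g` and `ω`. -/
noncomputable def chain (g : (ℕ → Bool) → ℝ) (ω : Path) (n : ℤ) : Bool :=
  open Classical in decide (∃ c : ℤ, ∀ a ≤ c, sim g ω a n = true)

/-- The innovations force `L` symbols `true` from time `s` on. -/
def Block (L : ℕ) (s : ℤ) (ω : Path) : Prop := ∀ i, s ≤ i → i < s + L → ω i < 1 / 4

/-- Blocks of any length occur arbitrarily far in the past. -/
def Recurrent (ω : Path) : Prop := ∀ (L : ℕ) (n : ℤ), ∃ s ≤ n, Block L s ω

theorem follows_sim (g : (ℕ → Bool) → ℝ) (ω : Path) {a n : ℤ} (h : a ≤ n) :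
    Follows g ω (sim g ω a) n := by
  unfold Follows recent
  rw [sim, if_neg (not_lt.2 h)]

theorem eq_of_step {x y : ℤ → Bool} {a c : ℤ}
    (h : ∀ n, a ≤ n → n ≤ c → (∀ i, a ≤ i → i < n → x i = y i) → x n = y n) :
    ∀ n, a ≤ n → n ≤ c → x n = y n := by
  have key : ∀ (k : ℕ) (n : ℤ), n < a + k → a ≤ n → n ≤ c → x n = y n := by
    intro k
    induction k with
    | zero => intro n h1 h2; push_cast at h1; omega
    | succ k ih =>
      intro n h1 h2 h3
      refine h n h2 h3 fun i hi hin => ih i ?_ hi (by omega)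
      push_cast at h1; omega
  intro n h1 h2
  exact key ((n - a).toNat + 1) n (by omega) h1 h2

variable {g : (ℕ → Bool) → ℝ} {L : ℕ} {b : ℝ} {ω : Path}

theorem Follows.eq_true (hg : IsRule g L b) {x : ℤ → Bool} {n : ℤ} (h : Follows g ω x n)
    (hω : ω n < 1 / 4) : x n = true := by
  rw [h]; simpa using hω.trans_le (hg.lower _)

theorem Follows.eq_false (hg : IsRule g L b) {x : ℤ → Bool} {n : ℤ} (h : Follows g ω x n)
    (hω : 3 / 4 ≤ ω n) : x n = false := by
  rw [h]; simpa using ((hg.upper _).trans hg.bound_lt.le).trans hω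

theorem Follows.eq_of_block (hg : IsRule g L b) {x y : ℤ → Bool} {s c : ℤ} (hs : Block L s ω)
    (hx : ∀ n, s ≤ n → n ≤ c → Follows g ω x n) (hy : ∀ n, s ≤ n → n ≤ c → Follows g ω y n) :
    ∀ n, s ≤ n → n ≤ c → x n = y n := by
  refine eq_of_step fun n h1 h2 h3 => ?_
  by_cases h4 : n < s + L
  · rw [(hx n h1 h2).eq_true hg (hs n h1 h4), (hy n h1 h2).eq_true hg (hs n h1 h4)]
  · rw [hx n h1 h2, hy n h1 h2, hg.finite_memory (recent x n) (recent y n)]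
    intro i hi
    exact h3 _ (by omega) (by omega)

theorem chain_eq_sim (hg : IsRule g L b) {s a n : ℤ} (hs : Block L s ω) (ha : a ≤ s)
    (hn : s ≤ n) : chain g ω n = sim g ω a n := by
  have key : ∀ a' ≤ s, sim g ω a' n = sim g ω a n := fun a' ha' =>
    Follows.eq_of_block hg hs (fun m h1 _ => follows_sim g ω (ha'.trans h1))
      (fun m h1 _ => follows_sim g ω (ha.trans h1)) n hn le_rfl
  unfold chain
  rw [Bool.eq_iff_iff]
  simp only [decide_eq_true_eq]
  constructor
  · rintro ⟨c, hc⟩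
    rw [← key (min c s) (min_le_right _ _)]
    exact hc _ (min_le_left _ _)
  · intro h
    exact ⟨s, fun a' ha' => (key a' ha').trans h⟩

theorem follows_chain (hg : IsRule g L b) (hω : Recurrent ω) (n : ℤ) :
    Follows g ω (chain g ω) n := by
  obtain ⟨s, hs, hb⟩ := hω L (n - L)
  have hsn : s ≤ n := by omega
  have := follows_sim g ω hsn
  unfold Follows at this ⊢
  rw [chain_eq_sim hg hb le_rfl hsn, this,
    hg.finite_memory (recent (sim g ω s) n) (recent (chain g ω) n)]
  intro i hi
  exact (chain_eq_sim hg hb le_rfl (by omega)).symm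

theorem sim_translate (g : (ℕ → Bool) → ℝ) (ω : Path) (m a n : ℤ) :
    sim g (translate m ω) a n = sim g ω (a + m) (n + m) := by
  by_cases h : n < a
  · rw [sim, sim, if_pos h, if_pos (by omega)]
  · rw [sim, sim, if_neg h, if_neg (by omega)]
    have : (fun i : ℕ => sim g (translate m ω) a (n - 1 - i)) =
        fun i : ℕ => sim g ω (a + m) (n + m - 1 - i) := by
      funext i
      rw [sim_translate g ω m a (n - 1 - i)]
      congr 1
      ring
    rw [this]
    rfl
termination_by (n + 1 - a).toNat
decreasing_by omega

theorem chain_translate (g : (ℕ → Bool) → ℝ) (ω : Path) (m n : ℤ) :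
    chain g (translate m ω) n = chain g ω (n + m) := by
  unfold chain
  rw [Bool.eq_iff_iff]
  simp only [decide_eq_true_eq, sim_translate]
  constructor
  · rintro ⟨c, hc⟩
    refine ⟨c + m, fun a ha => ?_⟩
    simpa using hc (a - m) (by omega)
  · rintro ⟨c, hc⟩
    exact ⟨c - m, fun a ha => hc _ (by omega)⟩

/-- The symbol at time `0` of the stationary sequence driven by `g`. -/
noncomputable def symbol (g : (ℕ → Bool) → ℝ) (ω : Path) : Bool := chain g ω 0

theorem symbol_translate (g : (ℕ → Bool) → ℝ) (ω : Path) (n : ℤ) :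
    symbol g (translate n ω) = chain g ω n := by
  rw [symbol, chain_translate, zero_add]

theorem sim_congr (g : (ℕ → Bool) → ℝ) {ω ω' : Path} (a n : ℤ)
    (h : ∀ i ∈ Set.Ico a (n + 1), ω i = ω' i) : sim g ω a n = sim g ω' a n := by
  by_cases hn : n < a
  · rw [sim, sim, if_pos hn, if_pos hn]
  · rw [sim, sim, if_neg hn, if_neg hn]
    have : (fun i : ℕ => sim g ω a (n - 1 - i)) = fun i : ℕ => sim g ω' a (n - 1 - i) := by
      funext i
      exact sim_congr g a (n - 1 - i) fun j hj => h j ⟨hj.1, by have := hj.2; omega⟩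
    rw [this, h n ⟨not_lt.1 hn, by omega⟩]
termination_by (n + 1 - a).toNat
decreasing_by omega

theorem chain_congr (g : (ℕ → Bool) → ℝ) {ω ω' : Path} (n : ℤ)
    (h : ∀ i < n + 1, ω i = ω' i) : chain g ω n = chain g ω' n := by
  have hsim : ∀ a, sim g ω a n = sim g ω' a n := fun a => sim_congr g a n fun i hi => h i hi.2
  unfold chain
  rw [Bool.eq_iff_iff]
  simp only [decide_eq_true_eq, hsim]

theorem measurable_decide_lt {α : Type*} [MeasurableSpace α] {f h : α → ℝ} (hf : Measurable f)
    (hh : Measurable h) : Measurable fun x => decide (f x < h x) := by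
  refine measurable_to_bool ?_
  convert measurableSet_lt hf hh using 1
  ext; simp

theorem measurable_sim (hg : Measurable g) (a n : ℤ) : Measurable fun ω => sim g ω a n := by
  by_cases h : n < a
  · have : (fun ω => sim g ω a n) = fun _ => true := by
      funext ω; rw [sim, if_pos h]
    rw [this]; exact measurable_const
  · have : (fun ω => sim g ω a n) = fun ω => decide (ω n < g fun i => sim g ω a (n - 1 - i)) := by
      funext ω; rw [sim, if_neg h]
    rw [this]
    refine measurable_decide_lt (measurable_pi_apply n) (hg.comp ?_)
    exact measurable_pi_lambda _ fun i => measurable_sim hg a (n - 1 - i)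
termination_by (n + 1 - a).toNat
decreasing_by omega

theorem measurable_chain (hg : Measurable g) (n : ℤ) : Measurable fun ω => chain g ω n := by
  refine measurable_to_bool ?_
  have : (fun ω => chain g ω n) ⁻¹' {true} =
      ⋃ c : ℤ, ⋂ a : ℤ, ⋂ _ : a ≤ c, {ω | sim g ω a n = true} := by
    ext ω; simp [chain]
  rw [this]
  exact MeasurableSet.iUnion fun c => MeasurableSet.iInter fun a => MeasurableSet.iInter fun _ =>
    measurable_sim hg a n (measurableSet_singleton true)

theorem measurable_symbol (hg : Measurable g) : Measurable (symbol g) := measurable_chain hg 0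

theorem measurableSet_block (L : ℕ) (s : ℤ) : MeasurableSet {ω | Block L s ω} := by
  have : {ω : Path | Block L s ω} =
      ⋂ i : ℤ, ⋂ _ : s ≤ i, ⋂ _ : i < s + L, {ω | ω i < 1 / 4} := by
    ext ω; simp [Block]
  rw [this]
  exact MeasurableSet.iInter fun i => MeasurableSet.iInter fun _ => MeasurableSet.iInter fun _ =>
    measurableSet_lt (measurable_pi_apply i) measurable_const

theorem determinedBy_block (L : ℕ) (s : ℤ) :
    DeterminedBy {ω | Block L s ω} (Set.Ico s (s + L)) := fun ω ω' h => by
  refine forall_congr' fun i => forall_congr' fun h1 => forall_congr' fun h2 => ?_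
  rw [h i ⟨h1, h2⟩]

theorem iidLaw_real_block (L : ℕ) (s : ℤ) : iidLaw.real {ω | Block L s ω} = (1 / 4) ^ L := by
  have : {ω : Path | Block L s ω} =
      {ω | ∀ i ∈ Finset.Ico s (s + L), ω i ∈ Set.Iio (1 / 4 : ℝ)} := by
    ext ω; simp [Block]
  rw [this, iidLaw_real_box _ _ fun _ => measurableSet_Iio, Finset.prod_const,
    unif_real_Iio (by norm_num) (by norm_num)]
  simp

/-- None of the `K` consecutive windows of length `L` before time `n` is a block. -/
def noBlock (L K : ℕ) (n : ℤ) : Set Path := {ω | ∀ k < K, ¬ Block L (n - (k + 1 : ℕ) * L) ω}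

theorem noBlock_succ (L K : ℕ) (n : ℤ) :
    noBlock L (K + 1) n = {ω | Block L (n - (K + 1 : ℕ) * L) ω}ᶜ ∩ noBlock L K n := by
  ext ω
  simp only [noBlock, Nat.lt_succ_iff_lt_or_eq, Set.mem_ofPred_eq, Set.mem_inter_iff,
    Set.mem_compl_iff]
  constructor
  · exact fun h => ⟨h K (Or.inr rfl), fun k hk => h k (Or.inl hk)⟩
  · rintro ⟨h1, h2⟩ k (hk | rfl)
    exacts [h2 k hk, h1]

theorem measurableSet_noBlock (L K : ℕ) (n : ℤ) : MeasurableSet (noBlock L K n) := by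
  induction K with
  | zero => simp [noBlock]
  | succ K ih => rw [noBlock_succ]; exact (measurableSet_block _ _).compl.inter ih

theorem determinedBy_noBlock (L K : ℕ) (n : ℤ) :
    DeterminedBy (noBlock L K n) (Set.Ico (n - K * L) n) := by
  induction K with
  | zero => intro ω ω' _; simp [noBlock]
  | succ K ih =>
    rw [noBlock_succ]
    refine ((determinedBy_block _ _).compl.mono ?_).inter (ih.mono ?_)
    · refine Set.Ico_subset_Ico le_rfl ?_
      push_cast
      nlinarith [show (0 : ℤ) ≤ K * L by positivity]
    · refine Set.Ico_subset_Ico ?_ le_rfl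
      push_cast
      nlinarith [show (0 : ℤ) ≤ L by positivity]

theorem iidLaw_real_noBlock (L K : ℕ) (n : ℤ) :
    iidLaw.real (noBlock L K n) = (1 - (1 / 4) ^ L) ^ K := by
  induction K with
  | zero => simp [noBlock]
  | succ K ih =>
    rw [noBlock_succ, iidLaw_real_inter (S := Set.Ico (n - (K + 1 : ℕ) * L) (n - K * L))
      (T := Set.Ico (n - K * L) n) _ (measurableSet_block _ _).compl (measurableSet_noBlock _ _ _)
      _ (determinedBy_noBlock _ _ _), ih,
      probReal_compl_eq_one_sub (measurableSet_block _ _), iidLaw_real_block, pow_succ']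
    · rw [Set.disjoint_left]
      rintro x ⟨_, h1⟩ ⟨h2, _⟩
      omega
    · refine (determinedBy_block _ _).compl.mono (Set.Ico_subset_Ico le_rfl ?_)
      push_cast
      linarith

theorem tendsto_noBlock (L : ℕ) (n : ℤ) :
    Tendsto (fun K => iidLaw.real (noBlock L K n)) atTop (𝓝 0) := by
  simp only [iidLaw_real_noBlock]
  refine tendsto_pow_atTop_nhds_zero_of_lt_one ?_ ?_
  · linarith [pow_le_one₀ (n := L) (show (0 : ℝ) ≤ 1 / 4 by norm_num) (by norm_num)]
  · linarith [pow_pos (show (0 : ℝ) < 1 / 4 by norm_num) L]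

theorem exists_noBlock_lt (L : ℕ) (n : ℤ) {η : ℝ} (hη : 0 < η) :
    ∃ K, iidLaw.real (noBlock L K n) < η :=
  ((tendsto_order.1 (tendsto_noBlock L n)).2 η hη).exists

theorem exists_block_of_notMem_noBlock {L K : ℕ} {n : ℤ} (h : ω ∉ noBlock L K n) :
    ∃ s, n - K * L ≤ s ∧ s + L ≤ n ∧ Block L s ω := by
  simp only [noBlock, Set.mem_ofPred_eq, not_forall, not_not] at h
  obtain ⟨k, hk, hb⟩ := h
  refine ⟨_, ?_, ?_, hb⟩
  · have : ((k + 1 : ℕ) : ℤ) ≤ K := by exact_mod_cast hk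
    nlinarith [show (0 : ℤ) ≤ L by positivity]
  · push_cast
    nlinarith [show (0 : ℤ) ≤ k * L by positivity]

theorem ae_recurrent : ∀ᵐ ω ∂iidLaw, Recurrent ω := by
  unfold Recurrent
  refine ae_all_iff.2 fun L => ae_all_iff.2 fun n => ?_
  have h0 : iidLaw.real (⋂ K, noBlock L K n) = 0 := by
    refine le_antisymm (ge_of_tendsto' (tendsto_noBlock L n) fun K => ?_) measureReal_nonneg
    exact measureReal_mono (Set.iInter_subset _ K)
  rw [measureReal_eq_zero_iff] at h0
  refine measure_mono_null (fun ω hω => Set.mem_iInter.2 fun K => ?_) h0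
  by_contra hK
  obtain ⟨s, -, h2, hb⟩ := exists_block_of_notMem_noBlock hK
  exact hω ⟨s, by omega, hb⟩

end

section

variable {g : (ℕ → Bool) → ℝ} {L : ℕ} {b : ℝ}

theorem orbit_symbol (g : (ℕ → Bool) → ℝ) (ω : Path) (n : ℕ) :
    orbit (symbol g) ω n = chain g ω n := symbol_translate g ω n

theorem ergodicFreq_symbol (hg : IsRule g L b) : ErgodicFreq (factorLaw (symbol g)) := by
  refine ergodicFreq_factorLaw (measurable_symbol hg.measurable) fun η hη => ?_
  obtain ⟨K, hK⟩ := exists_noBlock_lt L 0 hη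
  refine ⟨fun ω => sim g ω (0 - K * L) 0, noBlock L K 0, 0 - K * L, 1,
    measurable_sim hg.measurable _ _, measurableSet_noBlock _ _ _, fun ω ω' h => sim_congr g _ _ h,
    (determinedBy_noBlock L K 0).mono (Set.Ico_subset_Ico le_rfl (by norm_num)), hK.le,
    fun ω hω => ?_⟩
  obtain ⟨s, h1, h2, hb⟩ := exists_block_of_notMem_noBlock hω
  exact chain_eq_sim hg hb h1 (by omega)

theorem measurableSet_listCyl (w : List Bool) : MeasurableSet (listCyl w) := by
  have : listCyl w = ⋂ i : Fin w.length, (fun x : ℕ → Bool => x i) ⁻¹' {w.get i} := by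
    ext x; simp [listCyl]
  rw [this]
  exact MeasurableSet.iInter fun i => measurable_pi_apply _ (measurableSet_singleton _)

theorem factorLaw_apply (hg : IsRule g L b) {S : Set (ℕ → Bool)} (hS : MeasurableSet S) :
    factorLaw (symbol g) S = iidLaw {ω | (fun n : ℕ => chain g ω n) ∈ S} := by
  rw [factorLaw, Measure.map_apply (measurable_orbit (measurable_symbol hg.measurable)) hS]
  have : ∀ ω, orbit (symbol g) ω = fun n : ℕ => chain g ω n := fun ω =>
    funext (orbit_symbol g ω)
  simp only [Set.preimage, this]

/-- The past described by a word, most recent symbol first, padded with `true`. -/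
def pastOf (w : List Bool) : ℕ → Bool := fun i => w.reverse.getD i true

theorem recent_eq_pastOf {x : ℕ → Bool} {y : ℤ → Bool} (hxy : ∀ n : ℕ, x n = y n) {w : List Bool}
    (h : x ∈ listCyl w) {i : ℕ} (hi : i < w.length) : recent y w.length i = pastOf w i := by
  have h1 : ((w.length - 1 - i : ℕ) : ℤ) = (w.length : ℤ) - 1 - i := by omega
  rw [recent, ← h1, ← hxy, pastOf, List.getD_eq_getElem _ _ (by simpa using hi),
    List.getElem_reverse]
  exact h ⟨w.length - 1 - i, by omega⟩

theorem mem_listCyl_append (x : ℕ → Bool) (w : List Bool) (a : Bool) :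
    x ∈ listCyl (w ++ [a]) ↔ x ∈ listCyl w ∧ x w.length = a := by
  simp only [listCyl, Set.mem_ofPred_eq, Fin.forall_iff, List.length_append, List.length_singleton,
    List.get_eq_getElem]
  constructor
  · intro h
    refine ⟨fun i hi => ?_, ?_⟩
    · rw [h i (by omega), List.getElem_append_left hi]
    · rw [h _ (by omega)]; simp
  · rintro ⟨h1, h2⟩ i hi
    rcases Nat.lt_succ_iff_lt_or_eq.1 hi with h | rfl
    · rw [h1 i h, List.getElem_append_left h]
    · rw [h2]; simp

theorem iidLaw_coord (n : ℤ) {s : Set ℝ} (hs : MeasurableSet s) :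
    iidLaw {ω | ω n ∈ s} = unif s :=
  (measurePreserving_eval_infinitePi (fun _ : ℤ => unif) n).measure_preimage
    hs.nullMeasurableSet

theorem measurableSet_decide_lt (v : ℝ) (a : Bool) : MeasurableSet {u : ℝ | decide (u < v) = a} :=
  measurable_decide_lt measurable_id measurable_const (measurableSet_singleton a)

theorem factorLaw_listCyl_append (hg : IsRule g L b) {w : List Bool} (hw : L ≤ w.length)
    (a : Bool) : factorLaw (symbol g) (listCyl (w ++ [a])) =
      factorLaw (symbol g) (listCyl w) * unif {u | decide (u < g (pastOf w)) = a} := by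
  rw [factorLaw_apply hg (measurableSet_listCyl _), factorLaw_apply hg (measurableSet_listCyl _),
    ← iidLaw_coord w.length (measurableSet_decide_lt _ _)]
  have hm : Measurable fun (ω : Path) (n : ℕ) => chain g ω n :=
    measurable_pi_lambda _ fun n => measurable_chain hg.measurable n
  rw [← iidLaw_inter (E := {ω | (fun n : ℕ => chain g ω n) ∈ listCyl w})
    (F := {ω | ω w.length ∈ {u | decide (u < g (pastOf w)) = a}})
    (S := Set.Iio (w.length : ℤ)) (T := {(w.length : ℤ)}) (by simp)
    (hm (measurableSet_listCyl w))
    ((measurable_pi_apply _) (measurableSet_decide_lt (g (pastOf w)) a))]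
  · refine measure_congr ?_
    filter_upwards [ae_recurrent] with ω hω
    refine propext ((mem_listCyl_append _ w a).trans (and_congr_right fun h => ?_))
    have := follows_chain hg hω w.length
    unfold Follows at this
    rw [hg.finite_memory _ (pastOf w) fun i hi =>
      recent_eq_pastOf (fun n => rfl) h (hi.trans_le hw)] at this
    simp only [this]
    rfl
  · intro ω ω' h
    refine forall_congr' fun i => ?_
    have : chain g ω i = chain g ω' i := chain_congr g _ fun j hj => h j (by
      have := i.2
      simp only [Set.mem_Iio]
      omega)
    simp only [this]
  · intro ω ω' h
    have := h _ rfl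
    simp only [Set.mem_ofPred_eq, this]

theorem isMarkovOfOrder_symbol (hg : IsRule g L b) :
    IsMarkovOfOrder (factorLaw (symbol g)) L := by
  intro w a hw
  rw [factorLaw_listCyl_append hg hw, factorLaw_listCyl_append hg (by simp; omega),
    hg.finite_memory (pastOf w) (pastOf (w.drop (w.length - L)))]
  · ring
  · intro i hi
    unfold pastOf
    rw [List.getD_eq_getElem _ _ (by simp; omega), List.getD_eq_getElem _ _ (by simp; omega),
      List.getElem_reverse, List.getElem_reverse, List.getElem_drop]
    congr 1
    simp only [List.length_drop]
    omega

theorem iidLaw_real_forced (f : ℤ → Bool) (s : Finset ℤ) :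
    iidLaw.real {ω | ∀ i ∈ s, ω i ∈ if f i then Set.Iio (1 / 4 : ℝ) else Set.Ici (3 / 4)} =
      (1 / 4) ^ s.card := by
  rw [iidLaw_real_box s (fun i => if f i then Set.Iio (1 / 4 : ℝ) else Set.Ici (3 / 4))]
  · refine Finset.prod_eq_pow_card fun i _ => ?_
    split_ifs
    · rw [unif_real_Iio] <;> norm_num
    · rw [unif_real_Ici] <;> norm_num
  · intro i
    split_ifs
    exacts [measurableSet_Iio, measurableSet_Ici]

theorem iidLaw_chain_eq_ne_zero (hg : IsRule g L b) (f : ℤ → Bool) (s : Finset ℤ) :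
    iidLaw {ω | ∀ i ∈ s, chain g ω i = f i} ≠ 0 := by
  have h1 := iidLaw_real_forced f s
  intro h0
  have h2 : iidLaw
      {ω | ∀ i ∈ s, ω i ∈ if f i then Set.Iio (1 / 4 : ℝ) else Set.Ici (3 / 4)} = 0 := by
    refine measure_mono_null_ae ?_ h0
    filter_upwards [ae_recurrent] with ω hω h i hi
    have hf := follows_chain hg hω i
    have := h i hi
    cases hfi : f i
    · rw [hfi] at this
      exact hf.eq_false hg (by simpa using this)
    · rw [hfi] at this
      exact hf.eq_true hg (by simpa using this)
  rw [measureReal_def, h2] at h1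
  exact (pow_pos (show (0 : ℝ) < 1 / 4 by norm_num) s.card).ne h1

theorem factorLaw_listCyl_ne_zero (hg : IsRule g L b) (w : List Bool) :
    factorLaw (symbol g) (listCyl w) ≠ 0 := by
  rw [factorLaw_apply hg (measurableSet_listCyl _)]
  refine ne_of_gt (lt_of_lt_of_le (pos_iff_ne_zero.2 (iidLaw_chain_eq_ne_zero hg
    (fun i => w.getD i.toNat true) (Finset.Ico 0 w.length))) (measure_mono fun ω h i => ?_))
  have := h i (by simp)
  simpa using this

theorem aperiodicMarkov_symbol (hg : IsRule g L b) : AperiodicMarkov (factorLaw (symbol g)) L := by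
  intro u hu _ d hd
  have key : ∀ n, L ≤ n → d ∣ n := by
    intro n hn
    refine hd n (hg.pos.trans_le hn) ?_
    rw [factorLaw_apply hg ((measurableSet_listCyl _).inter ?_)]
    · refine ne_of_gt (lt_of_lt_of_le (pos_iff_ne_zero.2 (iidLaw_chain_eq_ne_zero hg
        (fun i => if i < L then u.getD i.toNat true else u.getD (i - n).toNat true)
        (Finset.Ico 0 (n + L)))) (measure_mono fun ω h => ⟨fun i => ?_, fun i => ?_⟩))
      · have := h i (by simp; omega)
        have hi := i.2
        rw [if_pos (by omega)] at this
        simpa using this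
      · have := h (n + i : ℕ) (by simp; omega)
        have hi := i.2
        rw [if_neg (by push_cast; omega)] at this
        simpa using this
    · have : {x : ℕ → Bool | ∀ i : Fin u.length, x (n + i) = u.get i} =
          ⋂ i : Fin u.length, (fun x : ℕ → Bool => x (n + i)) ⁻¹' {u.get i} := by
        ext x; simp
      rw [this]
      exact MeasurableSet.iInter fun i => measurable_pi_apply _ (measurableSet_singleton _)
  have h1 := key L le_rfl
  have h2 := key (L + 1) (by omega)
  exact Nat.dvd_one.1 ((Nat.dvd_add_right h1).1 h2)

theorem isBProcess_of_approx {ψ : Path → Bool} (hψ : Measurable ψ)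
    (h : ∀ η > (0 : ℝ), ∃ (g : (ℕ → Bool) → ℝ) (L : ℕ) (b : ℝ), IsRule g L b ∧
      iidLaw.real {ω | ψ ω ≠ symbol g ω} ≤ η) : IsBProcess (factorLaw ψ) := by
  refine ⟨isProbabilityMeasure_factorLaw hψ, stationary_factorLaw hψ, fun ε hε => ?_⟩
  obtain ⟨g, L, b, hg, hle⟩ := h ε hε
  have hm := measurable_symbol hg.measurable
  exact ⟨factorLaw (symbol g), L, isProbabilityMeasure_factorLaw hm, stationary_factorLaw hm,
    ergodicFreq_symbol hg, isMarkovOfOrder_symbol hg, aperiodicMarkov_symbol hg,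
    dbarLe_factorLaw hψ hm hle⟩

theorem isBProcess_symbol (hg : IsRule g L b) : IsBProcess (factorLaw (symbol g)) :=
  isBProcess_of_approx (measurable_symbol hg.measurable) fun η hη =>
    ⟨g, L, b, hg, by simpa using hη.le⟩

/-- The rule `g` with the probability of `true` after `true` raised by `ε`. -/
noncomputable def raise (g : (ℕ → Bool) → ℝ) (ε : ℝ) (mode : (ℕ → Bool) → Prop)
    (σ : ℕ → Bool) : ℝ :=
  open Classical in if σ 0 = true ∧ mode σ then g σ + ε else g σ

theorem isRule_raise (hg : IsRule g L b) {ε : ℝ} (h0 : 0 ≤ ε) (h1 : b + ε < 3 / 4)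
    {mode : (ℕ → Bool) → Prop} {M : ℕ} (hLM : L ≤ M)
    (hm : ∀ σ τ : ℕ → Bool, (∀ i < M, σ i = τ i) → (mode σ ↔ mode τ))
    (hmm : MeasurableSet {σ | mode σ}) :
    IsRule (raise g ε mode) M (b + ε) where
  measurable := by
    refine Measurable.ite ?_ (hg.measurable.add_const ε) hg.measurable
    exact (measurable_pi_apply 0 (measurableSet_singleton true)).inter hmm
  lower σ := by
    have := hg.lower σ
    unfold raise; split_ifs <;> linarith
  upper σ := by
    have := hg.upper σ
    unfold raise; split_ifs <;> linarith
  bound_lt := h1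
  fair σ h := by simp [raise, h, hg.fair σ h]
  pos := hg.pos.trans_le hLM
  finite_memory σ τ h := by
    have h1 : (σ 0 = true ∧ mode σ) ↔ (τ 0 = true ∧ mode τ) := by
      rw [h 0 (hg.pos.trans_le hLM), hm σ τ h]
    unfold raise
    rw [hg.finite_memory σ τ fun i hi => h i (hi.trans_le hLM)]
    by_cases h2 : τ 0 = true ∧ mode τ
    · rw [if_pos h2, if_pos (h1.2 h2)]
    · rw [if_neg h2, if_neg (mt h1.1 h2)]

theorem abs_raise_sub_le (g : (ℕ → Bool) → ℝ) {ε : ℝ} (h0 : 0 ≤ ε) (mode : (ℕ → Bool) → Prop)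
    (σ : ℕ → Bool) : |raise g ε mode σ - g σ| ≤ ε := by
  unfold raise
  split_ifs
  · simp [abs_of_nonneg h0]
  · simpa using h0

theorem factorLaw_raise_ne (hg : IsRule g L b) {ε : ℝ} (h0 : 0 < ε) (h1 : b + ε < 3 / 4) :
    factorLaw (symbol g) ≠ factorLaw (symbol (raise g ε fun _ => True)) := by
  intro heq
  have hg' : IsRule (raise g ε fun _ => True) L (b + ε) :=
    isRule_raise hg h0.le h1 le_rfl (fun _ _ _ => Iff.rfl) (by simp)
  set w := List.replicate L true with hw
  have hlen : L ≤ w.length := by simp [hw]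
  have e1 := factorLaw_listCyl_append hg hlen true
  have e2 := factorLaw_listCyl_append hg' hlen true
  rw [← heq, e1] at e2
  have := isProbabilityMeasure_factorLaw (measurable_symbol hg.measurable)
  have e3 := (ENNReal.mul_right_inj (factorLaw_listCyl_ne_zero hg w) (measure_ne_top _ _)).1 e2
  have e4 := congrArg ENNReal.toReal e3
  have hp : raise g ε (fun _ => True) (pastOf w) = g (pastOf w) + ε := by
    have : pastOf w 0 = true := by
      rw [pastOf, hw, List.reverse_replicate, List.getD_eq_getElem _ _ (by simpa using hg.pos)]
      simp
    simp [raise, this]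
  have hset : ∀ v : ℝ, {u : ℝ | decide (u < v) = true} = Set.Iio v := fun v => by ext; simp
  have l1 := hg.lower (pastOf w)
  have l2 := hg.upper (pastOf w)
  simp only [hp, hset] at e4
  change unif.real _ = unif.real _ at e4
  rw [unif_real_Iio (by linarith) (by linarith), unif_real_Iio (by linarith) (by linarith)] at e4
  linarith

end

section

variable {g : (ℕ → Bool) → ℝ} {L : ℕ} {b : ℝ}

theorem measureReal_le_of_ae {E F : Set Path} (h : ∀ᵐ ω ∂iidLaw, ω ∈ E → ω ∈ F) :
    iidLaw.real E ≤ iidLaw.real F :=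
  ENNReal.toReal_mono (measure_ne_top _ _) (measure_mono_ae h)

theorem IsRule.finite_range (hg : IsRule g L b) : (Set.range g).Finite := by
  refine (Set.finite_range fun f : Fin L → Bool =>
    g fun i => if h : i < L then f ⟨i, h⟩ else true).subset ?_
  rintro _ ⟨σ, rfl⟩
  exact ⟨fun i => σ i, hg.finite_memory _ _ fun i hi => by simp [hi]⟩

theorem exists_symbol_ne_le (hg : IsRule g L b) {η : ℝ} (hη : 0 < η) :
    ∃ ε > 0, ∀ (g' : (ℕ → Bool) → ℝ) (L' : ℕ) (b' : ℝ), IsRule g' L' b' →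
      (∀ σ, |g' σ - g σ| ≤ ε) → iidLaw.real {ω | symbol g ω ≠ symbol g' ω} ≤ η := by
  obtain ⟨K, hK⟩ := exists_noBlock_lt L 0 (half_pos hη)
  set V := hg.finite_range.toFinset with hV
  set T : Finset ℤ := Finset.Icc (0 - K * L) 0 with hT
  set ε : ℝ := η / (4 * ((T ×ˢ V).card + 1)) with hε
  have hε0 : 0 < ε := by positivity
  refine ⟨ε, hε0, fun g' L' b' hg' hle => ?_⟩
  set B : Set Path := ⋃ p ∈ T ×ˢ V, {ω | ω p.1 ∈ Set.Icc (p.2 - ε) (p.2 + ε)} with hB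
  have hBle : iidLaw.real B ≤ η / 2 := by
    refine (measureReal_biUnion_finset_le _ _).trans ?_
    refine (Finset.sum_le_card_nsmul _ _ (2 * ε) fun p _ => ?_).trans ?_
    · rw [measureReal_def, iidLaw_coord p.1 measurableSet_Icc]
      exact (unif_real_Icc_le (by linarith)).trans (by linarith)
    · rw [nsmul_eq_mul, hε, ← mul_div_assoc, ← mul_div_assoc,
        div_le_div_iff₀ (by positivity) two_pos]
      nlinarith
  refine (measureReal_le_of_ae (F := noBlock L K 0 ∪ B) ?_).trans
    ((measureReal_union_le _ _).trans (by linarith))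
  filter_upwards [ae_recurrent] with ω hω hne
  by_contra hnot
  simp only [Set.mem_union, not_or] at hnot
  obtain ⟨s, h1, h2, hb⟩ := exists_block_of_notMem_noBlock hnot.1
  refine hne (eq_of_step (x := chain g ω) (y := chain g' ω) (a := s) (c := 0) ?_ 0
    (by omega) le_rfl)
  intro n hn1 hn2 hn3
  have f1 := follows_chain hg hω n
  have f2 := follows_chain hg' hω n
  by_cases h4 : n < s + L
  · rw [f1.eq_true hg (hb n hn1 h4), f2.eq_true hg' (hb n hn1 h4)]
  · have hrec : g (recent (chain g ω) n) = g (recent (chain g' ω) n) :=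
      hg.finite_memory _ _ fun i hi => hn3 _ (by omega) (by omega)
    have hout : ω n ∉ Set.Icc (g (recent (chain g' ω) n) - ε) (g (recent (chain g' ω) n) + ε) := by
      intro hin
      refine hnot.2 (Set.mem_iUnion₂.2 ⟨(n, g (recent (chain g' ω) n)), ?_, hin⟩)
      rw [Finset.mem_product]
      exact ⟨Finset.mem_Icc.2 ⟨by omega, hn2⟩, by simp [hV]⟩
    have h5 := abs_le.1 (hle (recent (chain g' ω) n))
    rw [f1, f2, hrec]
    rw [Set.mem_Icc, not_and_or, not_le, not_le] at hout
    rw [Bool.eq_iff_iff]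
    simp only [decide_eq_true_eq]
    rcases hout with h | h
    · exact ⟨fun _ => by linarith, fun _ => by linarith⟩
    · exact ⟨fun _ => by linarith, fun _ => by linarith⟩

end

section

/-- `μ` dominates `α • ν` up to the additive error `e`. -/
def Dominates {β : Type*} [MeasurableSpace β] (α e : ℝ) (μ ν : Measure β) : Prop :=
  ∀ S : Set β, α * ν.real S - e ≤ μ.real S

theorem real_prod_eq_integral {β γ : Type*} [Finite β] [Finite γ] [MeasurableSpace β]
    [MeasurableSpace γ] [MeasurableSingletonClass β] [MeasurableSingletonClass γ]
    (μ : Measure β) (ν : Measure γ) [IsProbabilityMeasure μ] [IsProbabilityMeasure ν]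
    (R : Set (β × γ)) : (μ.prod ν).real R = ∫ x, ν.real (Prod.mk x ⁻¹' R) ∂μ := by
  rw [measureReal_def, Measure.prod_apply (Set.toFinite R).measurableSet,
    integral_eq_lintegral_of_nonneg_ae (ae_of_all _ fun _ => measureReal_nonneg)
      Integrable.of_finite.aestronglyMeasurable]
  simp

theorem Dominates.prod {β : Type*} [Finite β] [MeasurableSpace β] [MeasurableSingletonClass β]
    {α₁ α₂ e₁ e₂ : ℝ} {μ₁ μ₂ ν₁ ν₂ : Measure β} [IsProbabilityMeasure μ₁] [IsProbabilityMeasure μ₂]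
    [IsProbabilityMeasure ν₁] [IsProbabilityMeasure ν₂] (h₁ : Dominates α₁ e₁ μ₁ ν₁)
    (h₂ : Dominates α₂ e₂ μ₂ ν₂) (hα : 0 ≤ α₂) (hα' : α₂ ≤ 1) (he : 0 ≤ e₁) :
    Dominates (α₁ * α₂) (e₁ + e₂) (μ₁.prod μ₂) (ν₁.prod ν₂) := by
  intro R
  have key : ∀ {α e : ℝ} {μ ν κ : Measure β} [IsProbabilityMeasure μ] [IsProbabilityMeasure ν]
      [IsProbabilityMeasure κ], Dominates α e μ ν → ∀ R : Set (β × β),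
      α * (κ.prod ν).real R - e ≤ (κ.prod μ).real R := by
    intro α e μ ν κ _ _ _ h R
    rw [real_prod_eq_integral, real_prod_eq_integral, ← integral_const_mul]
    have : e = ∫ _, e ∂κ := by simp
    rw [this, ← integral_sub Integrable.of_finite Integrable.of_finite]
    exact integral_mono Integrable.of_finite Integrable.of_finite fun x => h _
  have swap : ∀ (μ ν : Measure β) [IsProbabilityMeasure μ] [IsProbabilityMeasure ν],
      (μ.prod ν).real R = (ν.prod μ).real (Prod.swap ⁻¹' R) := by
    intro μ ν _ _
    rw [← Measure.prod_swap, map_measureReal_apply measurable_swap (Set.toFinite R).measurableSet]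
  have k₁ := key (κ := ν₂) h₁ (Prod.swap ⁻¹' R)
  have k₂ := key (κ := μ₁) h₂ R
  rw [← swap, ← swap] at k₁
  nlinarith

/-- The law of the first `n` symbols read off by `φ`. -/
noncomputable def wordLaw (φ : Path → Bool) (n : ℕ) : Measure (Fin n → Bool) :=
  iidLaw.map fun ω (i : Fin n) => φ (translate (i : ℕ) ω)

theorem measurable_word {φ : Path → Bool} (hφ : Measurable φ) (n : ℕ) :
    Measurable fun ω (i : Fin n) => φ (translate (i : ℕ) ω) :=
  measurable_pi_lambda _ fun _ => hφ.comp (measurable_translate _)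

theorem isProbabilityMeasure_wordLaw {φ : Path → Bool} (hφ : Measurable φ) (n : ℕ) :
    IsProbabilityMeasure (wordLaw φ n) :=
  Measure.isProbabilityMeasure_map (measurable_word hφ n).aemeasurable

theorem wordLaw_real {φ : Path → Bool} (hφ : Measurable φ) (n : ℕ) (S : Set (Fin n → Bool)) :
    (wordLaw φ n).real S = iidLaw.real {ω | (fun i : Fin n => φ (translate (i : ℕ) ω)) ∈ S} := by
  rw [wordLaw, map_measureReal_apply (measurable_word hφ n) (Set.toFinite S).measurableSet]
  rfl

theorem wordLaw_symbol_real {g : (ℕ → Bool) → ℝ} (hg : Measurable g) (n : ℕ) (T : ℤ)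
    (S : Set (Fin n → Bool)) : (wordLaw (symbol g) n).real S =
      iidLaw.real {ω | (fun i : Fin n => chain g ω (T + (i : ℕ))) ∈ S} := by
  rw [wordLaw_real (measurable_symbol hg)]
  have h := (measurePreserving_translate T).measureReal_preimage
    ((measurable_word (measurable_symbol hg) n) (Set.toFinite S).measurableSet).nullMeasurableSet
  refine h.symm.trans ?_
  congr 1
  ext ω
  have : (fun i : Fin n => symbol g (translate (i : ℕ) (translate T ω))) =
      fun i : Fin n => chain g ω (T + (i : ℕ)) := by
    funext i
    rw [translate_translate, symbol_translate, add_comm]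
  simp only [Set.mem_preimage, Set.mem_ofPred_eq, this]

theorem expOut_factorLaw (D : (n : ℕ) → (Fin n → Bool) → (Fin n → Bool) → Bool)
    {φ ψ : Path → Bool} (hφ : Measurable φ) (hψ : Measurable ψ) (n : ℕ) :
    expOut D (factorLaw φ) (factorLaw ψ) n =
      ((wordLaw φ n).prod (wordLaw ψ n)).real {p | D n p.1 p.2 = true} := by
  have := isProbabilityMeasure_factorLaw hφ
  have := isProbabilityMeasure_factorLaw hψ
  have hp : Measurable fun (x : ℕ → Bool) (i : Fin n) => x i := by fun_prop
  have hw : ∀ {χ : Path → Bool}, Measurable χ →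
      wordLaw χ n = (factorLaw χ).map fun (x : ℕ → Bool) (i : Fin n) => x i := by
    intro χ hχ
    rw [factorLaw, Measure.map_map hp (measurable_orbit hχ)]
    rfl
  rw [hw hφ, hw hψ, Measure.map_prod_map _ _ hp hp,
    map_measureReal_apply (hp.prodMap hp) (Set.toFinite _).measurableSet, expOut]
  rw [← integral_indicator_one ((hp.prodMap hp) (Set.toFinite _).measurableSet)]
  refine integral_congr_ae (ae_of_all _ fun z => ?_)
  by_cases h : D n (fun i => z.1 i) (fun i => z.2 i) = true
  · rw [Set.indicator_of_mem (by simpa [Prod.map] using h)]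
    simp [h]
  · rw [Set.indicator_of_notMem (by simpa [Prod.map] using h)]
    simp [h]

theorem dominates_of_ne_le {φ ψ : Path → Bool} (hφ : Measurable φ) (hψ : Measurable ψ) (n : ℕ) :
    Dominates 1 (n * iidLaw.real {ω | ψ ω ≠ φ ω}) (wordLaw ψ n) (wordLaw φ n) := by
  intro S
  rw [wordLaw_real hφ, wordLaw_real hψ, one_mul, sub_le_iff_le_add]
  have hN : MeasurableSet {ω | ψ ω ≠ φ ω} := (measurableSet_eq_fun hψ hφ).compl
  refine (measureReal_mono (s₂ := _ ∪ ⋃ i ∈ Finset.range n,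
    translate (i : ℕ) ⁻¹' {ω | ψ ω ≠ φ ω}) fun ω hω => ?_).trans
    ((measureReal_union_le _ _).trans (add_le_add le_rfl
      ((measureReal_biUnion_finset_le _ _).trans_eq ?_)))
  · by_cases h : ∀ i < n, ψ (translate (i : ℕ) ω) = φ (translate (i : ℕ) ω)
    · left
      simp only [Set.mem_ofPred_eq] at hω ⊢
      convert hω using 2 with i
      exact h i i.2
    · right
      push Not at h
      obtain ⟨i, hi, hne⟩ := h
      exact Set.mem_iUnion₂.2 ⟨i, Finset.mem_range.2 hi, hne⟩
  · rw [Finset.sum_congr rfl fun i _ =>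
      (measurePreserving_translate (i : ℕ)).measureReal_preimage hN.nullMeasurableSet]
    simp

variable {g h : (ℕ → Bool) → ℝ} {L M : ℕ} {b c : ℝ}

theorem dominates_of_follows (hg : IsRule g M b) (hh : IsRule h L c) {K n : ℕ} {A Q : Set Path}
    (hA : MeasurableSet A) (hAd : DeterminedBy A (Set.Iio 0))
    (hf : ∀ᵐ ω ∂iidLaw, ω ∈ A → ω ∉ Q →
      ∀ t : ℤ, 0 ≤ t → t < K * L + n → Follows h ω (chain g ω) t) {α : ℝ} (hα : 0 ≤ α)
    (hαA : α ≤ iidLaw.real A) :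
    Dominates α (2 * iidLaw.real (noBlock L K (K * L)) + iidLaw.real Q)
      (wordLaw (symbol g) n) (wordLaw (symbol h) n) := by
  intro S
  rw [wordLaw_symbol_real hg.measurable n (K * L), wordLaw_symbol_real hh.measurable n (K * L)]
  set Y : Set Path := {ω | (fun i : Fin n => sim h ω 0 (K * L + (i : ℕ))) ∈ S} with hY
  set C := noBlock L K (K * L) with hC
  have hYm : MeasurableSet Y :=
    (measurable_pi_lambda _ fun i => measurable_sim hh.measurable _ _ :
      Measurable fun ω (i : Fin n) => sim h ω 0 (K * L + (i : ℕ))) (Set.toFinite S).measurableSet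
  have hYd : DeterminedBy Y (Set.Ici 0) := by
    intro ω ω' he
    have : ∀ i : Fin n, sim h ω 0 (K * L + (i : ℕ)) = sim h ω' 0 (K * L + (i : ℕ)) := fun i =>
      sim_congr h _ _ fun j hj => he j hj.1
    simp only [hY, Set.mem_ofPred_eq, this]
  have hind : iidLaw.real (A ∩ Y) = iidLaw.real A * iidLaw.real Y := by
    refine iidLaw_real_inter (S := Set.Iio 0) (T := Set.Ici 0) ?_ hA hYm hAd hYd
    rw [Set.disjoint_left]
    intro x h1 h2
    exact absurd (Set.mem_Iio.1 h1) (not_lt.2 (Set.mem_Ici.1 h2))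
  have e1 : iidLaw.real {ω | (fun i : Fin n => chain h ω (K * L + (i : ℕ))) ∈ S} ≤
      iidLaw.real Y + iidLaw.real C := by
    refine (measureReal_mono fun ω hω => ?_).trans (measureReal_union_le _ _)
    by_cases hc : ω ∈ C
    · exact Or.inr hc
    · obtain ⟨s, h1, h2, hb⟩ := exists_block_of_notMem_noBlock hc
      left
      simp only [hY, Set.mem_ofPred_eq] at hω ⊢
      convert hω using 2 with i
      exact (chain_eq_sim hh hb (a := 0) (n := K * L + (i : ℕ)) (by omega) (by omega)).symm
  have e2 : iidLaw.real (A ∩ Y) ≤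
      iidLaw.real {ω | (fun i : Fin n => chain g ω (K * L + (i : ℕ))) ∈ S} +
        (iidLaw.real C + iidLaw.real Q) := by
    refine (measureReal_le_of_ae ?_).trans ((measureReal_union_le _ _).trans
      (add_le_add le_rfl (measureReal_union_le C Q)))
    filter_upwards [hf] with ω hω hAY
    by_cases hc : ω ∈ C
    · exact Or.inr (Or.inl hc)
    by_cases hq : ω ∈ Q
    · exact Or.inr (Or.inr hq)
    obtain ⟨s, h1, h2, hb⟩ := exists_block_of_notMem_noBlock hc
    left
    have hYω := hAY.2
    simp only [hY, Set.mem_ofPred_eq] at hYω ⊢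
    convert hYω using 2 with i
    have hi := i.2
    refine Follows.eq_of_block hh hb (c := K * L + (i : ℕ))
      (fun t ht1 ht2 => hω hAY.1 hq t (by omega) (by omega))
      (fun t ht1 _ => follows_sim h ω (by omega)) _ (by omega) le_rfl
  have e3 := mul_le_mul_of_nonneg_left e1 hα
  have e4 : α * iidLaw.real Y ≤ iidLaw.real A * iidLaw.real Y :=
    mul_le_mul_of_nonneg_right hαA measureReal_nonneg
  have e5 : α * iidLaw.real C ≤ iidLaw.real C :=
    mul_le_of_le_one_left measureReal_nonneg (hαA.trans measureReal_le_one)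
  linarith

end

section

/-- Among the last `N` admissible starting times there is one where `true` is followed by
`m` symbols `false`. -/
def MarkerSeen (m N : ℕ) (σ : ℕ → Bool) : Prop :=
  ∃ i < N, σ (i + m) = true ∧ ∀ j < m, σ (i + j) = false

theorem markerSeen_congr {m N : ℕ} {σ τ : ℕ → Bool} (h : ∀ i < m + N, σ i = τ i) :
    MarkerSeen m N σ ↔ MarkerSeen m N τ := by
  refine exists_congr fun i => and_congr_right fun hi => ?_
  rw [h _ (by omega)]
  refine and_congr_right fun _ => forall_congr' fun j => forall_congr' fun hj => ?_
  rw [h _ (by omega)]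

theorem measurableSet_markerSeen (m N : ℕ) : MeasurableSet {σ | MarkerSeen m N σ} := by
  have : {σ | MarkerSeen m N σ} = ⋃ i : ℕ, ⋃ _ : i < N,
      ((fun σ : ℕ → Bool => σ (i + m)) ⁻¹' {true} ∩
        ⋂ j : ℕ, ⋂ _ : j < m, (fun σ : ℕ → Bool => σ (i + j)) ⁻¹' {false}) := by
    ext σ
    simpa [MarkerSeen] using exists_congr fun i => and_left_comm
  rw [this]
  exact MeasurableSet.iUnion fun i => MeasurableSet.iUnion fun _ =>
    (measurable_pi_apply _ (measurableSet_singleton _)).inter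
      (MeasurableSet.iInter fun j => MeasurableSet.iInter fun _ =>
        measurable_pi_apply _ (measurableSet_singleton _))

theorem markerSeen_recent {m N : ℕ} {x : ℤ → Bool} {n : ℤ} :
    MarkerSeen m N (recent x n) ↔ ∃ t, n - m - N ≤ t ∧ t < n - m ∧ x t = true ∧
      ∀ j, t < j → j ≤ t + m → x j = false := by
  unfold MarkerSeen recent
  constructor
  · rintro ⟨i, hi, h1, h2⟩
    refine ⟨n - 1 - (i + m : ℕ), by omega, by omega, h1, fun j hj1 hj2 => ?_⟩
    have := h2 (n - 1 - i - j).toNat (by omega)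
    convert this using 2
    omega
  · rintro ⟨t, h1, h2, h3, h4⟩
    refine ⟨(n - 1 - m - t).toNat, by omega, ?_, fun j hj => h4 _ (by omega) (by omega)⟩
    convert h3 using 2
    omega

/-- Innovations compatible with a marker of length `r + 1` at time `t`. -/
def mayMark (r : ℕ) (t : ℤ) : Set Path :=
  {ω | ∀ j ∈ Finset.Ico (t + 2) (t + 2 + r), ω j ∈ Set.Ici (1 / 2 : ℝ)}

/-- Innovations forcing a marker of length `r + 1` at time `t`. -/
def mustMark (r : ℕ) (t : ℤ) : Set Path :=
  {ω | ∀ j ∈ Finset.Ico t (t + 2 + r), ω j ∈ if j = t then Set.Iio (1 / 4 : ℝ) else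
    if j = t + 1 then Set.Ici (3 / 4) else Set.Ici (1 / 2)}

theorem measurableSet_box (s : Finset ℤ) {t : ℤ → Set ℝ} (ht : ∀ i, MeasurableSet (t i)) :
    MeasurableSet {ω : Path | ∀ i ∈ s, ω i ∈ t i} := by
  have : {ω : Path | ∀ i ∈ s, ω i ∈ t i} = ⋂ i ∈ s, (fun ω : Path => ω i) ⁻¹' t i := by
    ext ω; simp
  rw [this]
  exact Finset.measurableSet_biInter s fun i _ => measurable_pi_apply i (ht i)

theorem determinedBy_box (s : Finset ℤ) (t : ℤ → Set ℝ) :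
    DeterminedBy {ω : Path | ∀ i ∈ s, ω i ∈ t i} s := fun ω ω' h =>
  forall_congr' fun i => forall_congr' fun hi => by rw [h i hi]

theorem measurableSet_mayMark (r : ℕ) (t : ℤ) : MeasurableSet (mayMark r t) :=
  measurableSet_box _ fun _ => measurableSet_Ici

theorem measurableSet_mark_symbol (t j : ℤ) :
    MeasurableSet (if j = t then Set.Iio (1 / 4 : ℝ) else
      if j = t + 1 then Set.Ici (3 / 4) else Set.Ici (1 / 2)) := by
  split_ifs
  exacts [measurableSet_Iio, measurableSet_Ici, measurableSet_Ici]

theorem measurableSet_mustMark (r : ℕ) (t : ℤ) : MeasurableSet (mustMark r t) :=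
  measurableSet_box _ (measurableSet_mark_symbol t)

theorem determinedBy_mayMark (r : ℕ) (t : ℤ) :
    DeterminedBy (mayMark r t) (Set.Ico (t + 2) (t + 2 + r)) := by
  rw [← Finset.coe_Ico]
  exact determinedBy_box _ fun _ => Set.Ici (1 / 2 : ℝ)

theorem determinedBy_mustMark (r : ℕ) (t : ℤ) :
    DeterminedBy (mustMark r t) (Set.Ico t (t + 2 + r)) := by
  rw [← Finset.coe_Ico]
  exact determinedBy_box _ fun j =>
    if j = t then Set.Iio (1 / 4 : ℝ) else
      if j = t + 1 then Set.Ici (3 / 4) else Set.Ici (1 / 2)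

theorem iidLaw_real_mayMark (r : ℕ) (t : ℤ) : iidLaw.real (mayMark r t) = (1 / 2) ^ r := by
  rw [mayMark, iidLaw_real_box _ _ fun _ => measurableSet_Ici, Finset.prod_const,
    unif_real_Ici (by norm_num) (by norm_num)]
  norm_num

theorem iidLaw_real_mustMark (r : ℕ) (t : ℤ) :
    iidLaw.real (mustMark r t) = 1 / 16 * (1 / 2) ^ r := by
  have hs : Finset.Ico t (t + 2 + r) =
      insert t (insert (t + 1) (Finset.Ico (t + 2) (t + 2 + r))) := by
    ext j; simp only [Finset.mem_Ico, Finset.mem_insert]; omega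
  rw [mustMark, iidLaw_real_box _ (fun j => if j = t then Set.Iio (1 / 4 : ℝ) else
    if j = t + 1 then Set.Ici (3 / 4) else Set.Ici (1 / 2)) (measurableSet_mark_symbol t), hs,
    Finset.prod_insert (by simp), Finset.prod_insert (by simp),
    Finset.prod_congr rfl (g := fun _ => (1 / 2 : ℝ)), Finset.prod_const]
  · rw [if_pos rfl, if_neg (by omega), if_pos rfl, unif_real_Iio (by norm_num) (by norm_num),
      unif_real_Ici (by norm_num) (by norm_num)]
    simp only [Int.card_Ico, add_sub_cancel_left, Int.toNat_natCast]
    ring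
  · intro j hj
    rw [Finset.mem_Ico] at hj
    rw [if_neg (by omega), if_neg (by omega), unif_real_Ici (by norm_num) (by norm_num)]
    norm_num

theorem iidLaw_real_mustMark_inter_le (r : ℕ) {s t : ℤ} (h : s < t) :
    iidLaw.real (mustMark r t ∩ mustMark r s) ≤ (1 / 16 * (1 / 2) ^ r) ^ 2 := by
  by_cases hst : t < s + 2 + r
  · have : mustMark r t ∩ mustMark r s = ∅ := by
      refine Set.eq_empty_of_forall_notMem fun ω hω => ?_
      have h1 := hω.1 t (by simp; omega)
      have h2 := hω.2 t (by simp; omega)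
      rw [if_pos rfl, Set.mem_Iio] at h1
      rw [if_neg (by omega)] at h2
      split_ifs at h2 <;> rw [Set.mem_Ici] at h2 <;> linarith
    rw [this, measureReal_empty]
    positivity
  · rw [iidLaw_real_inter (S := Set.Ico t (t + 2 + r)) (T := Set.Ico s (s + 2 + r)) _
      (measurableSet_mustMark r t) (measurableSet_mustMark r s) (determinedBy_mustMark r t)
      (determinedBy_mustMark r s), iidLaw_real_mustMark, iidLaw_real_mustMark, sq]
    rw [Set.disjoint_left]
    rintro x ⟨h1, -⟩ ⟨-, h2⟩
    omega

theorem le_iidLaw_real_iUnion_mustMark (r : ℕ) (a : ℤ) (k : ℕ) :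
    k * (1 / 16 * (1 / 2) ^ r) - (k * (1 / 16 * (1 / 2 : ℝ) ^ r)) ^ 2 ≤
      iidLaw.real (⋃ i ∈ Finset.range k, mustMark r (a + i)) := by
  set p : ℝ := 1 / 16 * (1 / 2) ^ r with hp
  induction k with
  | zero => simp
  | succ k ih =>
    set U := ⋃ i ∈ Finset.range k, mustMark r (a + i) with hU
    have hsucc : (⋃ i ∈ Finset.range (k + 1), mustMark r (a + i)) = U ∪ mustMark r (a + k) := by
      rw [Finset.range_add_one, Finset.set_biUnion_insert, Set.union_comm]
    have hle : iidLaw.real (mustMark r (a + k) ∩ U) ≤ k * p ^ 2 := by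
      rw [hU, Set.inter_iUnion₂]
      refine (measureReal_biUnion_finset_le _ _).trans ((Finset.sum_le_card_nsmul _ _ (p ^ 2)
        fun i hi => iidLaw_real_mustMark_inter_le r ?_).trans_eq (by simp))
      have := Finset.mem_range.1 hi
      omega
    have hadd := measureReal_union_add_inter (μ := iidLaw) (s := U)
      (measurableSet_mustMark r (a + k)) (measure_ne_top _ _)
    rw [Set.inter_comm] at hadd
    have hm := iidLaw_real_mustMark r (a + k)
    rw [hsucc]
    push_cast
    nlinarith [mul_nonneg (Nat.cast_nonneg (α := ℝ) k) (sq_nonneg p), sq_nonneg p]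

variable {g : (ℕ → Bool) → ℝ} {L : ℕ} {b : ℝ} {ω : Path}

theorem Follows.fair (hg : IsRule g L b) {x : ℤ → Bool} {n : ℤ} (h : Follows g ω x n)
    (hx : x (n - 1) = false) : x n = decide (ω n < 1 / 2) := by
  rw [h, hg.fair _ (by simpa [recent] using hx)]

theorem mem_mayMark_of_marker (hg : IsRule g L b) {x : ℤ → Bool} (hx : ∀ n, Follows g ω x n)
    {r : ℕ} {t : ℤ} (h : ∀ j, t < j → j ≤ t + (r + 1 : ℕ) → x j = false) : ω ∈ mayMark r t := by
  intro j hj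
  rw [Finset.mem_Ico] at hj
  have h1 := (hx j).fair hg (h (j - 1) (by omega) (by omega))
  rw [h j (by omega) (by omega)] at h1
  simpa using h1.symm

theorem marker_of_mem_mustMark (hg : IsRule g L b) {x : ℤ → Bool} (hx : ∀ n, Follows g ω x n)
    {r : ℕ} {t : ℤ} (h : ω ∈ mustMark r t) :
    x t = true ∧ ∀ j, t < j → j ≤ t + (r + 1 : ℕ) → x j = false := by
  constructor
  · have := h t (by simp; omega)
    rw [if_pos rfl] at this
    exact (hx t).eq_true hg this
  · intro j hj1 hj2
    refine eq_of_step (x := x) (y := fun _ => false) (a := t + 1) (c := t + (r + 1 : ℕ)) ?_ j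
      (by omega) hj2
    intro n hn1 hn2 hn3
    have hω := h n (by simp; omega)
    rw [if_neg (by omega)] at hω
    split_ifs at hω with hn
    · exact (hx n).eq_false hg hω
    · rw [(hx n).fair hg (hn3 (n - 1) (by omega) (by omega))]
      simpa using hω

theorem Follows.of_apply_eq {h : (ℕ → Bool) → ℝ} {x : ℤ → Bool} {n : ℤ} (hx : Follows g ω x n)
    (heq : g (recent x n) = h (recent x n)) : Follows h ω x n := by
  unfold Follows at hx ⊢
  rw [← heq, hx]

end

section

variable {g : (ℕ → Bool) → ℝ} {L : ℕ} {b : ℝ} {ω : Path}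

theorem follows_raise_true_of_mode {ε : ℝ} {mode : (ℕ → Bool) → Prop} {x : ℤ → Bool} {n : ℤ}
    (hx : Follows (raise g ε mode) ω x n) (hm : mode (recent x n)) :
    Follows (raise g ε fun _ => True) ω x n :=
  hx.of_apply_eq (by simp [raise, hm])

theorem follows_of_not_mode {ε : ℝ} {mode : (ℕ → Bool) → Prop} {x : ℤ → Bool} {n : ℤ}
    (hx : Follows (raise g ε mode) ω x n) (hm : ¬ mode (recent x n)) : Follows g ω x n :=
  hx.of_apply_eq (by simp [raise, hm])

theorem dominates_unmarked (hg : IsRule g L b) {ε : ℝ} {r N K n : ℕ} {M : ℕ} {c : ℝ}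
    (hg' : IsRule (raise g ε (MarkerSeen (r + 1) N)) M c) (hN : N * (1 / 2 : ℝ) ^ r = 1 / 2)
    {e : ℝ} (hH : (K * L + n : ℕ) * (1 / 2 : ℝ) ^ r ≤ e)
    (hK : iidLaw.real (noBlock L K (K * L)) ≤ e) :
    Dominates (1 / 2) (3 * e) (wordLaw (symbol (raise g ε (MarkerSeen (r + 1) N))) n)
      (wordLaw (symbol g) n) := by
  have hU : ∀ (a : ℤ) (k : ℕ), iidLaw.real (⋃ i ∈ Finset.range k, mayMark r (a + i)) ≤
      k * (1 / 2) ^ r := fun a k => by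
    refine (measureReal_biUnion_finset_le _ _).trans_eq ?_
    rw [Finset.sum_congr rfl fun i _ => iidLaw_real_mayMark r (a + (i : ℕ))]
    simp
  have hUm : ∀ (a : ℤ) (k : ℕ), MeasurableSet (⋃ i ∈ Finset.range k, mayMark r (a + i)) :=
    fun a k => Finset.measurableSet_biUnion _ fun i _ => measurableSet_mayMark r _
  set A : Set Path := (⋃ i ∈ Finset.range N, mayMark r (-(r + 1 : ℕ) - N + i))ᶜ with hA
  set Q : Set Path := ⋃ i ∈ Finset.range (K * L + n), mayMark r (-(r + 1 : ℕ) + i) with hQ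
  have hdom := dominates_of_follows (K := K) (n := n) (A := A) (Q := Q) (α := 1 / 2) hg' hg
    (hUm _ _).compl ?_ ?_ (by norm_num) ?_
  · intro S
    have := hdom S
    have := hU (-(r + 1 : ℕ)) (K * L + n)
    linarith
  · refine DeterminedBy.compl fun ω ω' h => ?_
    simp only [Set.mem_iUnion]
    refine exists_congr fun i => exists_congr fun hi =>
      determinedBy_mayMark r _ ω ω' fun j hj => h j ?_
    have := Finset.mem_range.1 hi
    have := hj.2
    simp only [Set.mem_Iio]
    omega
  · filter_upwards [ae_recurrent] with ω hω hωA hωQ t ht0 ht1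
    have hx := follows_chain hg' hω
    refine follows_of_not_mode (hx t) fun hseen => ?_
    obtain ⟨s, hs1, hs2, -, hs3⟩ := markerSeen_recent.1 hseen
    have hmem := mem_mayMark_of_marker hg' hx hs3
    by_cases hs : s < -(r + 1 : ℕ)
    · refine hωA (Set.mem_iUnion₂.2 ⟨(s + (r + 1 : ℕ) + N).toNat, ?_, ?_⟩)
      · rw [Finset.mem_range]; omega
      · convert hmem using 2; push_cast at *; omega
    · refine hωQ (Set.mem_iUnion₂.2 ⟨(s + (r + 1 : ℕ)).toNat, ?_, ?_⟩)
      · rw [Finset.mem_range]; push_cast at *; omega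
      · convert hmem using 2; push_cast at *; omega
  · rw [hA, probReal_compl_eq_one_sub (hUm _ _)]
    linarith [hU (-(r + 1 : ℕ) - N) N]

theorem dominates_marked (hg : IsRule g L b) {ε : ℝ} (h0 : 0 ≤ ε) (h1 : b + ε < 3 / 4)
    {r N K n : ℕ} {M : ℕ} {c : ℝ} (hg' : IsRule (raise g ε (MarkerSeen (r + 1) N)) M c)
    (hN : N * (1 / 2 : ℝ) ^ r = 1 / 2) {e : ℝ} (hH : 2 * (K * L + n) ≤ N)
    (hK : iidLaw.real (noBlock L K (K * L)) ≤ e) :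
    Dominates (1 / 128) (2 * e) (wordLaw (symbol (raise g ε (MarkerSeen (r + 1) N))) n)
      (wordLaw (symbol (raise g ε fun _ => True)) n) := by
  have hg1 : IsRule (raise g ε fun _ => True) L (b + ε) :=
    isRule_raise hg h0 h1 le_rfl (fun _ _ _ => Iff.rfl) (by simp)
  set H := K * L + n with hHdef
  set A : Set Path := ⋃ i ∈ Finset.range (N - H), mustMark r (H - (r + 1 : ℕ) - N + i) with hA
  have hdom := dominates_of_follows (K := K) (n := n) (A := A) (Q := ∅) (α := 1 / 128) hg' hg1
    (Finset.measurableSet_biUnion _ fun i _ => measurableSet_mustMark r _) ?_ ?_ (by norm_num) ?_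
  · intro S
    have := hdom S
    rw [measureReal_empty] at this
    linarith
  · intro ω ω' h
    simp only [hA, Set.mem_iUnion]
    refine exists_congr fun i => exists_congr fun hi =>
      determinedBy_mustMark r _ ω ω' fun j hj => h j ?_
    have := Finset.mem_range.1 hi
    have := hj.2
    simp only [Set.mem_Iio]
    omega
  · filter_upwards [ae_recurrent] with ω hω hωA _ t ht0 ht1
    have hx := follows_chain hg' hω
    refine follows_raise_true_of_mode (hx t) (markerSeen_recent.2 ?_)
    obtain ⟨i, hi, hmem⟩ := Set.mem_iUnion₂.1 hωA
    have hi' := Finset.mem_range.1 hi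
    exact ⟨_, by push_cast at *; omega, by push_cast at *; omega,
      marker_of_mem_mustMark hg' hx hmem⟩
  · have hle := le_iidLaw_real_iUnion_mustMark r (H - (r + 1 : ℕ) - N) (N - H)
    refine le_trans ?_ hle
    have hq : (0 : ℝ) < (1 / 2) ^ r := by positivity
    have c1 : ((N - H : ℕ) : ℝ) ≤ N := by exact_mod_cast Nat.sub_le _ _
    have c2 : (N : ℝ) ≤ 2 * (N - H : ℕ) := by
      have : N ≤ 2 * (N - H) := by omega
      exact_mod_cast this
    set z : ℝ := (N - H : ℕ) * (1 / 16 * (1 / 2 : ℝ) ^ r) with hz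
    have z1 : z ≤ 1 / 32 := by nlinarith
    have z2 : 1 / 64 ≤ z := by nlinarith
    nlinarith

theorem exists_step (D : (n : ℕ) → (Fin n → Bool) → (Fin n → Bool) → Bool)
    (hD : ∀ ρx ρy : Measure (ℕ → Bool), IsBProcess ρx → IsBProcess ρy → ρx ≠ ρy →
      Tendsto (expOut D ρx ρy) atTop (𝓝 1))
    (hg : IsRule g L b) (N₀ : ℕ) {η : ℝ} (hη : 0 < η) :
    ∃ (g' : (ℕ → Bool) → ℝ) (L' : ℕ) (b' : ℝ) (n : ℕ), IsRule g' L' b' ∧ N₀ ≤ n ∧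
      iidLaw.real {ω | symbol g ω ≠ symbol g' ω} ≤ η ∧
      ∀ ψ : Path → Bool, Measurable ψ → n * iidLaw.real {ω | ψ ω ≠ symbol g' ω} ≤ 1 / 4096 →
        1 / 2048 ≤ expOut D (factorLaw ψ) (factorLaw ψ) n := by
  obtain ⟨ε₁, hε₁, hcont⟩ := exists_symbol_ne_le hg hη
  have hb := hg.bound_lt
  obtain ⟨ε, h0, hεlt⟩ := exists_between (lt_min hε₁ (sub_pos.2 hb))
  have hε1 : ε ≤ ε₁ := (hεlt.trans_le (min_le_left _ _)).le
  have h1 : b + ε < 3 / 4 := by linarith [hεlt.trans_le (min_le_right _ _)]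
  have hg1 : IsRule (raise g ε fun _ => True) L (b + ε) :=
    isRule_raise hg h0.le h1 le_rfl (fun _ _ _ => Iff.rfl) (by simp)
  obtain ⟨n, hn, hN₀⟩ := (((tendsto_order.1 (hD _ _ (isBProcess_symbol hg) (isBProcess_symbol hg1)
    (factorLaw_raise_ne hg h0 h1))).1 (1 / 2) (by norm_num)).and (eventually_ge_atTop N₀)).exists
  obtain ⟨K, hK⟩ := exists_noBlock_lt L 0 (show (0 : ℝ) < 1 / 16384 by norm_num)
  have hK' : iidLaw.real (noBlock L K (K * L)) ≤ 1 / 16384 := by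
    rw [iidLaw_real_noBlock] at hK ⊢
    exact hK.le
  set j := (K * L + n) * 8192 with hj
  have hpow : j < 2 ^ j := Nat.lt_two_pow_self
  have hpowR : (j : ℝ) < 2 ^ j := by exact_mod_cast hpow
  have hN : ((2 ^ j : ℕ) : ℝ) * (1 / 2 : ℝ) ^ (j + 1) = 1 / 2 := by
    push_cast
    rw [pow_succ, ← mul_assoc, ← mul_pow]
    norm_num
  have hH : ((K * L + n : ℕ) : ℝ) * (1 / 2 : ℝ) ^ (j + 1) ≤ 1 / 16384 := by
    have e1 : (j : ℝ) = (K * L + n : ℕ) * 8192 := by rw [hj, Nat.cast_mul]; norm_num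
    have e2 : (0 : ℝ) < (1 / 2) ^ (j + 1) := by positivity
    push_cast at hN
    nlinarith
  have hg' : IsRule (raise g ε (MarkerSeen (j + 1 + 1) (2 ^ j)))
      (L + (j + 1 + 1 + 2 ^ j)) (b + ε) :=
    isRule_raise hg h0.le h1 (by omega)
      (fun σ τ h => markerSeen_congr fun i hi => h i (by omega)) (measurableSet_markerSeen _ _)
  refine ⟨_, _, _, n, hg', hN₀, hcont _ _ _ hg' fun σ => (abs_raise_sub_le g h0.le _ σ).trans hε1,
    fun ψ hψ hle => ?_⟩
  have d0 := dominates_unmarked hg hg' hN hH hK'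
  have d1 := dominates_marked (n := n) hg h0.le h1 hg' hN (by omega) hK'
  have dψ := dominates_of_ne_le (measurable_symbol hg'.measurable) hψ n
  have := isProbabilityMeasure_wordLaw hψ n
  have := isProbabilityMeasure_wordLaw (measurable_symbol hg'.measurable) n
  have := isProbabilityMeasure_wordLaw (measurable_symbol hg.measurable) n
  have := isProbabilityMeasure_wordLaw (measurable_symbol hg1.measurable) n
  have p1 := d0.prod d1 (by norm_num) (by norm_num) (by norm_num) {p | D n p.1 p.2 = true}
  have p2 := dψ.prod dψ (by norm_num) (by norm_num) (by positivity) {p | D n p.1 p.2 = true}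
  rw [expOut_factorLaw D (measurable_symbol hg.measurable) (measurable_symbol hg1.measurable)] at hn
  rw [expOut_factorLaw D hψ hψ]
  linarith

end

theorem exists_limit_symbol {φ : ℕ → Path → Bool} (hφ : ∀ k, Measurable (φ k)) {δ : ℕ → ℝ}
    (hδ0 : ∀ k, 0 ≤ δ k) (hδ : ∀ k, δ (k + 1) ≤ δ k / 2)
    (h : ∀ k, iidLaw.real {ω | φ k ω ≠ φ (k + 1) ω} ≤ δ k) :
    ∃ ψ : Path → Bool, Measurable ψ ∧ ∀ k, iidLaw.real {ω | ψ ω ≠ φ k ω} ≤ 2 * δ k := by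
  classical
  refine ⟨fun ω => decide (∃ m, ∀ k ≥ m, φ k ω = true), ?_, fun k => ?_⟩
  · refine measurable_to_bool ?_
    have : (fun ω => decide (∃ m, ∀ k ≥ m, φ k ω = true)) ⁻¹' {true} =
        ⋃ m : ℕ, ⋂ k : ℕ, ⋂ _ : m ≤ k, φ k ⁻¹' {true} := by
      ext ω; simp
    rw [this]
    exact MeasurableSet.iUnion fun m => MeasurableSet.iInter fun k => MeasurableSet.iInter fun _ =>
      hφ k (measurableSet_singleton true)
  · have hδk : ∀ j, δ (k + j) ≤ 2 * δ k / 2 / 2 ^ j := by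
      intro j
      induction j with
      | zero => simp
      | succ j ih =>
        refine (hδ (k + j)).trans ?_
        rw [pow_succ, ← div_div]
        linarith
    refine ENNReal.toReal_le_of_le_ofReal (by linarith [hδ0 k]) ?_
    calc iidLaw {ω | decide (∃ m, ∀ k ≥ m, φ k ω = true) ≠ φ k ω}
        ≤ iidLaw (⋃ j : ℕ, {ω | φ (k + j) ω ≠ φ (k + j + 1) ω}) := by
          refine measure_mono fun ω hω => ?_
          by_contra hnot
          simp only [Set.mem_iUnion, Set.mem_ofPred_eq, not_exists, not_not] at hnot
          have hconst : ∀ j, φ (k + j) ω = φ k ω := by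
            intro j
            induction j with
            | zero => rfl
            | succ j ih => rw [← ih, hnot j]; rfl
          refine hω (Bool.eq_iff_iff.2 ?_)
          rw [decide_eq_true_eq]
          constructor
          · rintro ⟨m, hm⟩
            rw [← hconst m]
            exact hm _ (by omega)
          · intro hk
            refine ⟨k, fun i hi => ?_⟩
            obtain ⟨j, rfl⟩ := Nat.exists_eq_add_of_le hi
            rw [hconst j, hk]
      _ ≤ ∑' j : ℕ, iidLaw {ω | φ (k + j) ω ≠ φ (k + j + 1) ω} := measure_iUnion_le _
      _ ≤ ∑' j : ℕ, ENNReal.ofReal (2 * δ k / 2 / 2 ^ j) := by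
          refine ENNReal.tsum_le_tsum fun j => ?_
          exact (ENNReal.le_ofReal_iff_toReal_le (measure_ne_top _ _)
            (measureReal_nonneg.trans ((h _).trans (hδk j)))).2 ((h _).trans (hδk j))
      _ = ENNReal.ofReal (2 * δ k) := by
          rw [← ENNReal.ofReal_tsum_of_nonneg (fun j => ?_) (summable_geometric_two' (2 * δ k)),
            tsum_geometric_two']
          exact (hδ0 _).trans (hδk j)

theorem isRule_half : IsRule (fun _ => 1 / 2) 1 (1 / 2) where
  measurable := measurable_const
  lower _ := by norm_num
  upper _ := le_rfl
  bound_lt := by norm_num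
  fair _ _ := rfl
  pos := one_pos
  finite_memory _ _ _ := rfl

theorem exists_confusing_symbol (D : (n : ℕ) → (Fin n → Bool) → (Fin n → Bool) → Bool)
    (hD : ∀ ρx ρy : Measure (ℕ → Bool), IsBProcess ρx → IsBProcess ρy → ρx ≠ ρy →
      Tendsto (expOut D ρx ρy) atTop (𝓝 1)) :
    ∃ ψ : Path → Bool, IsBProcess (factorLaw ψ) ∧
      ∀ N, ∃ n ≥ N, 1 / 2048 ≤ expOut D (factorLaw ψ) (factorLaw ψ) n := by
  let State : Type := {s : ((ℕ → Bool) → ℝ) × ℝ // (∃ L b, IsRule s.1 L b) ∧ 0 < s.2}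
  have step : ∀ (N : ℕ) (s : State), ∃ s' : State,
      iidLaw.real {ω | symbol s.1.1 ω ≠ symbol s'.1.1 ω} ≤ s.1.2 ∧ s'.1.2 ≤ s.1.2 / 2 ∧
      ∃ n ≥ N, ∀ ψ : Path → Bool, Measurable ψ →
        iidLaw.real {ω | ψ ω ≠ symbol s'.1.1 ω} ≤ 2 * s'.1.2 →
        1 / 2048 ≤ expOut D (factorLaw ψ) (factorLaw ψ) n := by
    rintro N ⟨⟨g, δ⟩, ⟨L, b, hg⟩, hδ⟩
    obtain ⟨g', L', b', n, hg', hn, hclose, hbad⟩ := exists_step D hD hg N hδ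
    refine ⟨⟨(g', min (δ / 2) (1 / (8192 * (n + 1)))), ⟨L', b', hg'⟩, ?_⟩, hclose,
      min_le_left _ _, n, hn, fun ψ hψ hle => hbad ψ hψ ?_⟩
    · exact lt_min (half_pos hδ) (by positivity)
    · have h1 : iidLaw.real {ω | ψ ω ≠ symbol g' ω} ≤ 2 * (1 / (8192 * (n + 1))) :=
        hle.trans (by gcongr; exact min_le_right _ _)
      refine (mul_le_mul_of_nonneg_left h1 (Nat.cast_nonneg n)).trans ?_
      rw [← mul_assoc, mul_one_div, div_le_div_iff₀ (by positivity) (by norm_num)]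
      linarith
  choose next hnext using step
  let s : ℕ → State := fun k => k.rec ⟨(fun _ => 1 / 2, 1), ⟨1, 1 / 2, isRule_half⟩, one_pos⟩ next
  have hm : ∀ k, Measurable (symbol (s k).1.1) := fun k => by
    obtain ⟨L, b, hg⟩ := (s k).2.1
    exact measurable_symbol hg.measurable
  obtain ⟨ψ, hψ, hle⟩ := exists_limit_symbol hm (fun k => (s k).2.2.le)
    (fun k => (hnext k (s k)).2.1) fun k => (hnext k (s k)).1
  refine ⟨ψ, isBProcess_of_approx hψ fun η hη => ?_, fun N => ?_⟩
  · have hδ : ∀ k, (s k).1.2 ≤ (1 / 2) ^ k := by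
      intro k
      induction k with
      | zero => simp [s]
      | succ k ih =>
        refine ((hnext k (s k)).2.1).trans ?_
        rw [pow_succ]
        linarith
    obtain ⟨k, hk⟩ := exists_pow_lt_of_lt_one (half_pos hη) (show (1 / 2 : ℝ) < 1 by norm_num)
    obtain ⟨L, b, hg⟩ := (s k).2.1
    exact ⟨_, L, b, hg, (hle k).trans (by linarith [hδ k])⟩
  · obtain ⟨n, hn, hbad⟩ := (hnext N (s N)).2.2
    exact ⟨n, hn, hbad ψ hψ (hle (N + 1))⟩

/-- There is no asymptotically consistent discrimination procedure for the
set of all (binary-valued) B-processes: for every discrimination procedure `D` there are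
B-processes `ρx`, `ρy` such that either `ρx = ρy` and `E D_n` fails to converge to 0, or
`ρx ≠ ρy` and `E D_n` fails to converge to 1. -/
theorem no_consistent_discrimination_for_B_processes
    (D : (n : ℕ) → (Fin n → Bool) → (Fin n → Bool) → Bool)
    (hD : ∀ n, Measurable fun p : (Fin n → Bool) × (Fin n → Bool) => D n p.1 p.2) :
    ∃ ρx ρy : Measure (ℕ → Bool), IsBProcess ρx ∧ IsBProcess ρy ∧
      ((ρx = ρy ∧ ¬ Tendsto (expOut D ρx ρy) atTop (𝓝 0)) ∨
       (ρx ≠ ρy ∧ ¬ Tendsto (expOut D ρx ρy) atTop (𝓝 1))) := by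
  by_contra hcon
  have hD1 : ∀ ρx ρy : Measure (ℕ → Bool), IsBProcess ρx → IsBProcess ρy → ρx ≠ ρy →
      Tendsto (expOut D ρx ρy) atTop (𝓝 1) := fun ρx ρy hx hy hne => by
    by_contra h
    exact hcon ⟨ρx, ρy, hx, hy, Or.inr ⟨hne, h⟩⟩
  obtain ⟨ψ, hψ, hbad⟩ := exists_confusing_symbol D hD1
  refine hcon ⟨_, _, hψ, hψ, Or.inl ⟨rfl, fun ht => ?_⟩⟩
  obtain ⟨N, hN⟩ := eventually_atTop.1 ((tendsto_order.1 ht).2 (1 / 2048) (by norm_num))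
  obtain ⟨n, hn, hle⟩ := hbad N
  exact absurd (hN n hn) (not_lt.2 hle)

end Paper
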